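/- Let (T,M) be a complete Noetherian local ring. Then T is the completion of a noncatenary Noetherian local domain if and only if: (i) no nonzero element of the prime subring of T is a zerodivisor in T, (ii) M is not an associated prime of T, and (iii) there exists a minimal prime P of T with 1 < dim(T/P) < dim T. -/

import Mathlib

open IsLocalRing

/-- A chain of primes indexed by `Fin (n+1)` is saturated if each step is a covering
relation in `Spec`. -/
def IsSaturatedChain {R : Type} [CommRing R] {n : ℕ} (f : Fin (n + 1) → PrimeSpectrum R) : Prop :=
  ∀ i : Fin n, f i.castSucc ⋖ f i.succ

/-- A ring is catenary if any two saturated chains of primes with the same endpoints have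
the same length. -/
def IsCatenary (R : Type) [CommRing R] : Prop :=
  ∀ (n m : ℕ) (f : Fin (n + 1) → PrimeSpectrum R) (g : Fin (m + 1) → PrimeSpectrum R),
    IsSaturatedChain f → IsSaturatedChain g → f 0 = g 0 →
    f (Fin.last n) = g (Fin.last m) → n = m

/-! ### Regular sequences modulo ideals and catenarity -/

/-- Multiplication by `x` is injective modulo `I`. -/
def RegularMod {R : Type*} [CommRing R] (I : Ideal R) (x : R) : Prop :=
  ∀ a, x * a ∈ I → a ∈ I

/-- `P` is an associated prime of `R ⧸ I`. -/
def AssociatedMod {R : Type*} [CommRing R] (I P : Ideal R) : Prop :=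
  P.IsPrime ∧ ∃ u, ∀ r, r ∈ P ↔ r * u ∈ I

/-- There is a sequence of length `n` in `m` which is regular modulo `I`. -/
def HasDepth {R : Type*} [CommRing R] (m : Ideal R) : ℕ → Ideal R → Prop
  | 0, _ => True
  | n + 1, I => ∃ x ∈ m, RegularMod I x ∧ HasDepth m n (I ⊔ Ideal.span {x})

section Depth

variable {R : Type*} [CommRing R]

lemma mem_sup_span_singleton_iff {I : Ideal R} {x a : R} :
    a ∈ I ⊔ Ideal.span {x} ↔ ∃ i ∈ I, ∃ b, i + x * b = a := by
  rw [Submodule.mem_sup]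
  constructor
  · rintro ⟨i, hi, y, hy, rfl⟩
    obtain ⟨b, rfl⟩ := Ideal.mem_span_singleton'.1 hy
    exact ⟨i, hi, b, by ring⟩
  · rintro ⟨i, hi, b, rfl⟩
    exact ⟨i, hi, x * b, Ideal.mul_mem_right _ _ (Ideal.mem_span_singleton_self x), rfl⟩

/-- If no multiple of `v` by an element outside `q` lies in `J`, then there is an associated
prime of `R ⧸ J` between the annihilator of `v` and `q`. -/
lemma exists_associatedMod_le [IsNoetherianRing R] {J q : Ideal R} (hq : q.IsPrime) {v : R}
    (hv : ∀ s, s ∉ q → s * v ∉ J) :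
    ∃ P, AssociatedMod J P ∧ (∀ r, r * v ∈ J → r ∈ P) ∧ P ≤ q := by
  let col : R → Ideal R := fun x => Submodule.comap (LinearMap.toSpanSingleton R R x) J
  have hcol : ∀ x r, r ∈ col x ↔ r * x ∈ J := fun x r => by simp [col]
  let S : Set (Ideal R) := {K | ∃ r, (∀ s, s ∉ q → s * (r * v) ∉ J) ∧ K = col (r * v)}
  have hS : S.Nonempty := ⟨col (1 * v), 1, by simpa using hv, rfl⟩
  obtain ⟨K, ⟨r, hr, rfl⟩, hmax⟩ := set_has_maximal_iff_noetherian.2 inferInstance S hS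
  have key : ∀ c, (∀ s, s ∉ q → s * (c * r * v) ∉ J) → ∀ a, a * (c * r * v) ∈ J →
      a * (r * v) ∈ J := by
    intro c hc a ha
    by_contra hcon
    refine hmax (col (c * r * v)) ⟨c * r, hc, rfl⟩ (lt_of_le_of_ne ?_ ?_)
    · intro t ht
      rw [hcol] at ht ⊢
      have := J.mul_mem_left c ht
      convert this using 1; ring
    · intro heq
      rw [← hcol, heq, hcol] at hcon
      exact hcon ha
  have hle : col (r * v) ≤ q := by
    intro t ht
    by_contra htq
    exact hr t htq ((hcol _ _).1 ht)
  refine ⟨col (r * v), ⟨⟨?_, ?_⟩, r * v, hcol _⟩, ?_, hle⟩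
  · intro h
    exact hq.ne_top (top_le_iff.1 (h ▸ hle))
  · intro a b hab
    rw [hcol] at hab
    by_cases hb : ∀ s, s ∉ q → s * (b * r * v) ∉ J
    · left
      rw [hcol]
      refine key b hb a ?_
      convert hab using 1; ring
    · right
      push Not at hb
      obtain ⟨s, hs, hsb⟩ := hb
      rw [hcol]
      refine key s ?_ b ?_
      · intro t ht
        have := hr (t * s) (fun h => (hq.mem_or_mem h).elim ht hs)
        convert this using 2; ring
      · convert hsb using 1; ring
  · intro t ht
    rw [hcol]
    have := J.mul_mem_left r ht
    convert this using 1; ring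

lemma exists_associatedMod_le_of_le [IsNoetherianRing R] {J q : Ideal R} (hq : q.IsPrime)
    (h : J ≤ q) : ∃ P, AssociatedMod J P ∧ J ≤ P ∧ P ≤ q := by
  obtain ⟨P, hP, h1, h2⟩ := exists_associatedMod_le hq (J := J) (v := 1)
    (fun s hs => by rw [mul_one]; exact fun hJ => hs (h hJ))
  exact ⟨P, hP, fun r hr => h1 r (by simpa using hr), h2⟩

lemma AssociatedMod.notMem_of_regularMod {I P : Ideal R} (h : AssociatedMod I P) {x : R}
    (hx : RegularMod I x) : x ∉ P := by
  obtain ⟨hP, u, hu⟩ := h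
  intro hxP
  have h1 := hx u ((hu x).1 hxP)
  exact hP.ne_top ((Ideal.eq_top_iff_one _).2 ((hu 1).2 (by simpa using h1)))

lemma AssociatedMod.le {I P : Ideal R} (h : AssociatedMod I P) : I ≤ P := by
  obtain ⟨hP, u, hu⟩ := h
  exact fun r hr => (hu r).2 (I.mul_mem_right _ hr)

/-- An associated prime `p` of `R ⧸ I` specializes to an associated prime of `R ⧸ (I + y)`
inside any given prime `q` containing `p` and the regular element `y`. -/
lemma AssociatedMod.exists_sup_span [IsNoetherianRing R] {I p q : Ideal R}
    (hp : AssociatedMod I p) (hq : q.IsPrime) (hpq : p ≤ q) {y : R} (hy : y ∈ q)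
    (hreg : RegularMod I y) :
    ∃ P, AssociatedMod (I ⊔ Ideal.span {y}) P ∧ p ≤ P ∧ y ∈ P ∧ P ≤ q := by
  obtain ⟨hpp, u, hu⟩ := hp
  let Sat : Ideal R → Ideal R := fun J =>
    { carrier := {x | ∃ s, s ∉ q ∧ s * x ∈ J}
      zero_mem' := ⟨1, fun h => hq.ne_top ((Ideal.eq_top_iff_one _).2 h), by simp⟩
      add_mem' := by
        rintro a b ⟨s, hs, hsa⟩ ⟨t, ht, htb⟩
        refine ⟨s * t, fun h => (hq.mem_or_mem h).elim hs ht, ?_⟩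
        have := J.add_mem (J.mul_mem_left t hsa) (J.mul_mem_left s htb)
        convert this using 1; ring
      smul_mem' := by
        rintro c x ⟨s, hs, hsx⟩
        refine ⟨s, hs, ?_⟩
        have := J.mul_mem_left c hsx
        convert this using 1; simp only [smul_eq_mul]; ring }
  have hSat : ∀ J x, x ∈ Sat J ↔ ∃ s, s ∉ q ∧ s * x ∈ J := fun J x => Iff.rfl
  have hmul : ∀ {s t}, s ∉ q → t ∉ q → s * t ∉ q := fun hs ht h =>
    (hq.mem_or_mem h).elim hs ht
  let S : Set (Ideal R) :=
    {K | ∃ v, (∀ r ∈ p, r * v ∈ I) ∧ v ∉ Sat I ∧ K = Sat (I ⊔ Ideal.span {v})}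
  have hS : S.Nonempty := by
    refine ⟨_, u, fun r hr => (hu r).1 hr, ?_, rfl⟩
    rintro ⟨s, hs, hsu⟩
    exact hs (hpq ((hu s).2 hsu))
  obtain ⟨K, ⟨v, hvN, hv, rfl⟩, hmax⟩ := set_has_maximal_iff_noetherian.2 inferInstance S hS
  have hvy : v ∉ Sat (I ⊔ Ideal.span {y}) := by
    rintro ⟨s, hs, hsv⟩
    obtain ⟨i, hi, w, hw⟩ := mem_sup_span_singleton_iff.1 hsv
    have hwN : ∀ r ∈ p, r * w ∈ I := by
      intro r hr
      apply hreg
      have h1 : y * (r * w) = s * (r * v) - r * i := by linear_combination r * hw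
      rw [h1]
      exact I.sub_mem (I.mul_mem_left _ (hvN r hr)) (I.mul_mem_left _ hi)
    have hwS : w ∉ Sat I := by
      rintro ⟨t, ht, htw⟩
      refine hv ⟨t * s, hmul ht hs, ?_⟩
      have h1 : t * s * v = t * i + y * (t * w) := by linear_combination (-t) * hw
      rw [h1]
      exact I.add_mem (I.mul_mem_left _ hi) (I.mul_mem_left _ htw)
    have hw2 : w ∈ Sat (I ⊔ Ideal.span {v}) := by
      by_contra hcon
      refine hmax _ ⟨w, hwN, hwS, rfl⟩ (lt_of_le_of_ne ?_ ?_)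
      · rintro x ⟨t, ht, htx⟩
        obtain ⟨j, hj, b, hb⟩ := mem_sup_span_singleton_iff.1 htx
        refine ⟨s * t, hmul hs ht, mem_sup_span_singleton_iff.2
          ⟨s * j + i * b, I.add_mem (I.mul_mem_left _ hj) (I.mul_mem_right _ hi), y * b, ?_⟩⟩
        linear_combination s * hb + b * hw
      · intro heq
        apply hcon
        rw [heq]
        exact ⟨1, fun h => hq.ne_top ((Ideal.eq_top_iff_one _).2 h),
          by rw [one_mul]; exact Ideal.mem_sup_right (Ideal.mem_span_singleton_self w)⟩
    obtain ⟨t, ht, htw⟩ := hw2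
    obtain ⟨j, hj, b, hb⟩ := mem_sup_span_singleton_iff.1 htw
    refine hv ⟨t * s - y * b, fun h => hmul ht hs ?_, ?_⟩
    · have := q.add_mem h (q.mul_mem_right b hy)
      simpa using this
    · have h1 : (t * s - y * b) * v = t * i + y * j := by
        linear_combination (-t) * hw - y * hb
      rw [h1]
      exact I.add_mem (I.mul_mem_left _ hi) (I.mul_mem_left _ hj)
  obtain ⟨P, hP, h1, h2⟩ := exists_associatedMod_le hq (J := I ⊔ Ideal.span {y}) (v := v)
    (fun s hs h => hvy ⟨s, hs, h⟩)
  refine ⟨P, hP, fun r hr => h1 r (Ideal.mem_sup_left (hvN r hr)), ?_, h2⟩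
  exact hP.le (Ideal.mem_sup_right (Ideal.mem_span_singleton_self y))

lemma associatedMod_iff [IsNoetherianRing R] {I P : Ideal R} :
    AssociatedMod I P ↔ P ∈ associatedPrimes R (R ⧸ I) := by
  rw [AssociatedPrimes.mem_iff, isAssociatedPrime_iff, AssociatedMod]
  refine and_congr_right fun _ => ⟨?_, ?_⟩
  · rintro ⟨u, hu⟩
    refine ⟨Ideal.Quotient.mk I u, ?_⟩
    ext r
    rw [hu, Submodule.mem_colon_singleton, Submodule.mem_bot, ← Ideal.Quotient.eq_zero_iff_mem,
      map_mul, Algebra.smul_def]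
    rfl
  · rintro ⟨x, rfl⟩
    obtain ⟨u, rfl⟩ := Ideal.Quotient.mk_surjective x
    refine ⟨u, fun r => ?_⟩
    rw [Submodule.mem_colon_singleton, Submodule.mem_bot, ← Ideal.Quotient.eq_zero_iff_mem,
      map_mul, Algebra.smul_def]
    rfl

/-- Prime avoidance for the associated primes of finitely many quotients. -/
lemma exists_regularMod [IsNoetherianRing R] {m : Ideal R} (s : Finset (Ideal R))
    (h : ∀ J ∈ s, ∀ P, AssociatedMod J P → ¬ m ≤ P) :
    ∃ z ∈ m, ∀ J ∈ s, RegularMod J z := by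
  have hfin : (⋃ J ∈ s, associatedPrimes R (R ⧸ J)).Finite :=
    s.finite_toSet.biUnion fun J _ => associatedPrimes.finite R (R ⧸ J)
  by_contra! hcon
  have hsub : (m : Set R) ⊆ ⋃ P ∈ (⋃ J ∈ s, associatedPrimes R (R ⧸ J)), (P : Set R) := by
    intro z hz
    obtain ⟨J, hJ, hzJ⟩ := hcon z hz
    simp only [RegularMod, not_forall] at hzJ
    obtain ⟨a, ha, haJ⟩ := hzJ
    have : z ∈ ⋃ P ∈ associatedPrimes R (R ⧸ J), (P : Set R) := by
      rw [biUnion_associatedPrimes_eq_zero_divisors]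
      refine ⟨Ideal.Quotient.mk J a, fun h => haJ (Ideal.Quotient.eq_zero_iff_mem.1 h), ?_⟩
      rw [← Ideal.Quotient.eq_zero_iff_mem, map_mul] at ha
      rwa [Algebra.smul_def]
    simp only [Set.mem_iUnion] at this ⊢
    obtain ⟨P, hP, hzP⟩ := this
    exact ⟨P, ⟨J, hJ, hP⟩, hzP⟩
  obtain ⟨P, hP, hmP⟩ := (m.subset_union_prime_finite hfin (f := id) 0 0 (fun P hP _ _ => by
    simp only [Set.mem_iUnion] at hP
    obtain ⟨J, hJ, hP⟩ := hP
    exact hP.1)).1 hsub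
  simp only [Set.mem_iUnion] at hP
  obtain ⟨J, hJ, hP⟩ := hP
  exact h J hJ P (associatedMod_iff.2 hP) hmP

lemma RegularMod.swap {I : Ideal R} {x z : R} (hx : RegularMod I x)
    (hz : RegularMod (I ⊔ Ideal.span {x}) z) : RegularMod (I ⊔ Ideal.span {z}) x := by
  intro a ha
  obtain ⟨i, hi, b, hb⟩ := mem_sup_span_singleton_iff.1 ha
  have h1 : b ∈ I ⊔ Ideal.span {x} := by
    refine hz b (mem_sup_span_singleton_iff.2 ⟨-i, I.neg_mem hi, a, ?_⟩)
    linear_combination -hb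
  obtain ⟨j, hj, c, hc⟩ := mem_sup_span_singleton_iff.1 h1
  refine mem_sup_span_singleton_iff.2 ⟨a - z * c, hx _ ?_, c, by ring⟩
  have h2 : x * (a - z * c) = i + z * j := by linear_combination -hb - z * hc
  rw [h2]
  exact I.add_mem hi (I.mul_mem_left _ hj)

/-- Exchange property: regular sequences may be started with any regular element. -/
lemma HasDepth.sup_span [IsNoetherianRing R] {m : Ideal R} {n : ℕ} : ∀ {I : Ideal R},
    HasDepth m (n + 1) I → ∀ {y : R}, y ∈ m → RegularMod I y →
    HasDepth m n (I ⊔ Ideal.span {y}) := by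
  induction n with
  | zero => intros; trivial
  | succ n ih =>
    rintro I ⟨x, hxm, hx, hdep⟩ y hym hy
    obtain ⟨x', hx'm, hx', -⟩ := id hdep
    classical
    obtain ⟨z, hzm, hz⟩ := exists_regularMod (m := m)
      {I, I ⊔ Ideal.span {x}, I ⊔ Ideal.span {y}} (by
        intro J hJ P hP hmP
        simp only [Finset.mem_insert, Finset.mem_singleton] at hJ
        rcases hJ with rfl | rfl | rfl
        · exact hP.notMem_of_regularMod hx (hmP hxm)
        · exact hP.notMem_of_regularMod hx' (hmP hx'm)
        · obtain ⟨hPp, u, hu⟩ := hP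
          have hmu : ∀ r ∈ m, r * u ∈ I ⊔ Ideal.span {y} := fun r hr => (hu r).1 (hmP hr)
          obtain ⟨i, hi, w, hw⟩ := mem_sup_span_singleton_iff.1 (hmu x hxm)
          have hwx : w ∈ I ⊔ Ideal.span {x} := by
            apply hx'
            obtain ⟨i', hi', w', hw'⟩ := mem_sup_span_singleton_iff.1 (hmu x' hx'm)
            refine mem_sup_span_singleton_iff.2 ⟨x' * w - x * w', hy _ ?_, w', by ring⟩
            have h1 : y * (x' * w - x * w') = x * i' - x' * i := by
              linear_combination x' * hw - x * hw'
            rw [h1]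
            exact I.sub_mem (I.mul_mem_left _ hi') (I.mul_mem_left _ hi)
          obtain ⟨j, hj, t, ht⟩ := mem_sup_span_singleton_iff.1 hwx
          have hu1 : u ∈ I ⊔ Ideal.span {y} := by
            refine mem_sup_span_singleton_iff.2 ⟨u - y * t, hx _ ?_, t, by ring⟩
            have h1 : x * (u - y * t) = i + y * j := by linear_combination -hw - y * ht
            rw [h1]
            exact I.add_mem hi (I.mul_mem_left _ hj)
          exact hPp.ne_top ((Ideal.eq_top_iff_one _).2 ((hu 1).2 (by simpa using hu1))))
    have hzI := hz I (by simp)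
    have hzx := hz (I ⊔ Ideal.span {x}) (by simp)
    have hzy := hz (I ⊔ Ideal.span {y}) (by simp)
    have h1 : HasDepth m n (I ⊔ Ideal.span {z} ⊔ Ideal.span {x}) := by
      rw [sup_right_comm]
      exact ih hdep hzm hzx
    have h2 : HasDepth m (n + 1) (I ⊔ Ideal.span {z}) := ⟨x, hxm, hx.swap hzx, h1⟩
    have h3 := ih h2 hym (hy.swap hzy)
    rw [sup_right_comm] at h3
    exact ⟨z, hzm, hzy, h3⟩

lemma HasDepth.le_coheight [IsLocalRing R] [IsNoetherianRing R] {n : ℕ} : ∀ {I : Ideal R},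
    HasDepth (maximalIdeal R) n I → ∀ {P : PrimeSpectrum R}, AssociatedMod I P.asIdeal →
    (n : ℕ∞) ≤ Order.coheight P := by
  induction n with
  | zero => intros; simp
  | succ n ih =>
    rintro I ⟨x, hxm, hx, hdep⟩ P hP
    obtain ⟨P', hP', h1, h2, h3⟩ := hP.exists_sup_span (maximalIdeal.isMaximal R).isPrime
      (le_maximalIdeal P.2.ne_top) hxm hx
    have h4 := ih hdep (P := ⟨P', hP'.1⟩) hP'
    have h5 : P < ⟨P', hP'.1⟩ := lt_of_le_of_ne h1 (fun h => by
      apply hP.notMem_of_regularMod hx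
      rw [h]; exact h2)
    calc ((n + 1 : ℕ) : ℕ∞) = n + 1 := by push_cast; rfl
      _ ≤ Order.coheight (⟨P', hP'.1⟩ : PrimeSpectrum R) + 1 := by gcongr
      _ ≤ Order.coheight P := Order.coheight_add_one_le h5

/-- In a local ring with a regular sequence as long as its dimension, covering primes have
coheights differing by one. -/
theorem coheight_eq_of_hasDepth [IsLocalRing R] [IsNoetherianRing R] {d : ℕ}
    (hdep : HasDepth (maximalIdeal R) d ⊥)
    (hdim : ∀ P : PrimeSpectrum R, Order.coheight P ≤ d) {p q : PrimeSpectrum R} (hpq : p ⋖ q) :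
    Order.coheight p = Order.coheight q + 1 := by
  refine le_antisymm ?_ (Order.coheight_add_one_le hpq.lt)
  have build : ∀ d : ℕ, ∀ I : Ideal R, I ≤ p.asIdeal → HasDepth (maximalIdeal R) d I →
      (∀ P : PrimeSpectrum R, I ≤ P.asIdeal → Order.coheight P ≤ d) →
      ∃ (e : ℕ) (I : Ideal R), HasDepth (maximalIdeal R) e I ∧ I ≤ p.asIdeal ∧
        (∀ P : PrimeSpectrum R, I ≤ P.asIdeal → Order.coheight P ≤ e) ∧
        ∃ P : PrimeSpectrum R, AssociatedMod I P.asIdeal ∧ p ≤ P := by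
    intro d
    induction d with
    | zero =>
      intro I hI h1 h2
      obtain ⟨P, hP, -, hPp⟩ := exists_associatedMod_le_of_le p.2 hI
      refine ⟨0, I, h1, hI, h2, ⟨P, hP.1⟩, hP, le_of_eq ?_⟩
      by_contra hne
      have : (⟨P, hP.1⟩ : PrimeSpectrum R) < p := lt_of_le_of_ne hPp (Ne.symm hne)
      have h3 := (Order.coheight_add_one_le this).trans (h2 _ hP.le)
      simp at h3
    | succ d ih =>
      intro I hI h1 h2
      by_cases hcase : ∃ P : PrimeSpectrum R, AssociatedMod I P.asIdeal ∧ p ≤ P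
      · exact ⟨d + 1, I, h1, hI, h2, hcase⟩
      obtain ⟨y, hyp, hy⟩ := exists_regularMod (m := p.asIdeal) {I} (by
        intro J hJ P hP hle
        rw [Finset.mem_singleton] at hJ
        subst hJ
        exact hcase ⟨⟨P, hP.1⟩, hP, hle⟩)
      have hy := hy I (by simp)
      refine ih (I ⊔ Ideal.span {y}) (sup_le hI ?_)
        (h1.sup_span (le_maximalIdeal p.2.ne_top hyp) hy) ?_
      · rw [Ideal.span_le]; simpa using hyp
      · intro P hP
        obtain ⟨P', hP', -, hle⟩ := exists_associatedMod_le_of_le P.2 (le_sup_left.trans hP)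
        have hlt : (⟨P', hP'.1⟩ : PrimeSpectrum R) < P := by
          refine lt_of_le_of_ne hle ?_
          rintro rfl
          exact hP'.notMem_of_regularMod hy
            (hP (Ideal.mem_sup_right (Ideal.mem_span_singleton_self y)))
        have h3 := (Order.coheight_add_one_le hlt).trans (h2 _ hP'.le)
        push_cast at h3
        exact (ENat.add_le_add_iff_right (by simp)).1 h3
  obtain ⟨e, I, h1, hIp, h2, P, hP, hpP⟩ := build d ⊥ bot_le hdep (fun P _ => hdim P)
  have hPe := h1.le_coheight hP
  have hpP : p = P := by
    by_contra hne
    have h3 := (Order.coheight_add_one_le (lt_of_le_of_ne hpP hne)).trans (h2 p hIp)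
    have h4 := (add_le_add_left hPe 1).trans h3
    exact absurd h4 (by norm_cast; omega)
  subst hpP
  have hpe : Order.coheight p = e := le_antisymm (h2 p hIp) hPe
  have hqe : Order.coheight q + 1 ≤ e := hpe ▸ Order.coheight_add_one_le hpq.lt
  obtain ⟨y, hyq, hy⟩ := exists_regularMod (m := q.asIdeal) {I} (by
    intro J hJ P hPJ hle
    rw [Finset.mem_singleton] at hJ
    subst hJ
    have h3 := h1.le_coheight (P := ⟨P, hPJ.1⟩) hPJ
    have h4 : Order.coheight (⟨P, hPJ.1⟩ : PrimeSpectrum R) ≤ Order.coheight q :=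
      Order.coheight_anti hle
    have h5 := (add_le_add_left (h3.trans h4) 1).trans hqe
    exact absurd h5 (by norm_cast; omega))
  have hy := hy I (by simp)
  obtain ⟨P', hP', hpP, hyP, hPq⟩ := hP.exists_sup_span q.2 hpq.le hyq hy
  have hPq : (⟨P', hP'.1⟩ : PrimeSpectrum R) = q := by
    by_contra hne
    refine hpq.2 (c := ⟨P', hP'.1⟩) (lt_of_le_of_ne hpP ?_) (lt_of_le_of_ne hPq hne)
    intro h
    apply hP.notMem_of_regularMod hy
    rw [h]; exact hyP
  subst hPq
  rw [hpe]
  cases e with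
  | zero => simp
  | succ e =>
    have h3 := (h1.sup_span (le_maximalIdeal hP'.1.ne_top hyq) hy).le_coheight
      (P := ⟨P', hP'.1⟩) hP'
    push_cast
    gcongr

end Depth

section PowerSeries

lemma surjective_of_isPrecomplete {R S : Type*} [CommRing R] [CommRing S] (φ : R →+* S)
    (I : Ideal R) [IsPrecomplete I R] [IsHausdorff (I.map φ) S]
    (h : ∀ s, ∃ r, s - φ r ∈ I.map φ) : Function.Surjective φ := by
  have step : ∀ n : ℕ, ∀ s ∈ I.map φ ^ n, ∃ r ∈ I ^ n, s - φ r ∈ I.map φ ^ (n + 1) := by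
    intro n s hs
    rw [← Ideal.map_pow] at hs
    induction hs using Submodule.span_induction with
    | mem x hx =>
      obtain ⟨r, hr, rfl⟩ := hx
      exact ⟨r, hr, by simp⟩
    | zero => exact ⟨0, by simp, by simp⟩
    | add x y _ _ hx hy =>
      obtain ⟨r, hr, hr'⟩ := hx
      obtain ⟨t, ht, ht'⟩ := hy
      refine ⟨r + t, add_mem hr ht, ?_⟩
      have := add_mem hr' ht'
      rw [map_add]; convert this using 1; ring
    | smul a x hx' hx =>
      obtain ⟨r, hr, hr'⟩ := hx
      obtain ⟨b, hb⟩ := h a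
      refine ⟨b * r, Ideal.mul_mem_left _ _ hr, ?_⟩
      have h1 : a * x - φ (b * r) = (a - φ b) * φ r + a * (x - φ r) := by
        rw [map_mul]; ring
      rw [smul_eq_mul, h1]
      refine add_mem ?_ (Ideal.mul_mem_left _ _ hr')
      rw [pow_succ']
      refine Ideal.mul_mem_mul hb ?_
      rw [← Ideal.map_pow]
      exact Ideal.mem_map_of_mem _ hr
  intro s
  choose f hf hf' using step
  let u : ∀ n : ℕ, {x : R // s - φ x ∈ I.map φ ^ n} := fun n => Nat.rec ⟨0, by simp⟩
    (fun n x => ⟨x.1 + f n _ x.2, by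
      have := hf' n _ x.2
      rw [map_add]; convert this using 1; ring⟩) n
  have hu : ∀ n, (u (n + 1)).1 = (u n).1 + f n _ (u n).2 := fun n => rfl
  obtain ⟨L, hL⟩ := IsPrecomplete.prec (I := I) (M := R) inferInstance (f := fun n => (u n).1) (by
    intro m n hmn
    induction n, hmn using Nat.le_induction with
    | base => exact SModEq.refl _
    | succ n hmn ih =>
      refine ih.trans ?_
      rw [SModEq.sub_mem, hu]
      have := hf n _ (u n).2
      simp only [sub_add_cancel_left, smul_eq_mul, Ideal.mul_top, neg_mem_iff]
      exact Ideal.pow_le_pow_right hmn this)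
  refine ⟨L, ?_⟩
  rw [eq_comm, ← sub_eq_zero]
  refine IsHausdorff.haus (I := I.map φ) inferInstance _ fun n => ?_
  rw [SModEq.zero, smul_eq_mul, Ideal.mul_top]
  have h1 := hL n
  rw [SModEq.sub_mem, smul_eq_mul, Ideal.mul_top] at h1
  have h2 := Ideal.mem_map_of_mem φ h1
  rw [Ideal.map_pow, map_sub] at h2
  convert add_mem (u n).2 h2 using 1
  ring

open scoped MvPowerSeries.WithPiTopology in
lemma exists_ringHom_mvPowerSeries {W T : Type*} [CommRing W] [CommRing T] (I : Ideal T)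
    [IsAdicComplete I T] (g : W →+* T) {σ : Type*} [Finite σ] (t : σ → T) (ht : ∀ i, t i ∈ I) :
    ∃ φ : MvPowerSeries σ W →+* T, (∀ w, φ (MvPowerSeries.C w) = g w) ∧
      ∀ i, φ (MvPowerSeries.X i) = t i := by
  let : UniformSpace W := ⊥
  have : DiscreteUniformity W := ⟨rfl⟩
  let : WithIdeal T := ⟨I⟩
  have hT : CompleteSpace T ∧ T2Space T :=
    (IsAdic.isAdicComplete_iff (I := I) rfl).1 inferInstance
  have := hT.1
  have := hT.2
  have : IsLinearTopology T T := Ideal.isLinearTopology I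
  have hg : Continuous g := continuous_of_discreteTopology
  have ha : MvPowerSeries.HasEval t :=
    { hpow := fun i => by
        rw [IsTopologicallyNilpotent, (Ideal.hasBasis_nhds_zero_adic I).tendsto_right_iff]
        intro n _
        filter_upwards [Filter.eventually_ge_atTop n] with m hm
        exact Ideal.pow_le_pow_right hm (Ideal.pow_mem_pow (ht i) m)
      tendsto_zero := by simp [Filter.cofinite_eq_bot] }
  refine ⟨MvPowerSeries.eval₂Hom hg ha, fun w => ?_, fun i => ?_⟩
  · rw [MvPowerSeries.coe_eval₂Hom, MvPowerSeries.eval₂_C]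
  · rw [MvPowerSeries.coe_eval₂Hom, MvPowerSeries.eval₂_X]

namespace MvPowerSeries

variable {W : Type*} [CommRing W] {n : ℕ}

/-- The power series all of whose monomials involve one of the first `i` variables. -/
def initialVarsIdeal (W : Type*) [CommRing W] (n i : ℕ) : Ideal (MvPowerSeries (Fin n) W) where
  carrier := {f | ∀ d, (∀ j : Fin n, (j : ℕ) < i → d j = 0) → coeff d f = 0}
  zero_mem' := by simp
  add_mem' := by
    intro f g hf hg d hd
    simp [hf d hd, hg d hd]
  smul_mem' := by
    classical
    intro c f hf d hd
    rw [smul_eq_mul, coeff_mul]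
    refine Finset.sum_eq_zero fun p hp => ?_
    rw [hf p.2, mul_zero]
    intro j hj
    have h1 := DFunLike.congr_fun (Finset.HasAntidiagonal.mem_antidiagonal.1 hp) j
    rw [hd j hj, Finsupp.add_apply] at h1
    omega

lemma initialVarsIdeal_zero : initialVarsIdeal W n 0 = ⊥ := by
  refine eq_bot_iff.2 fun f hf => ?_
  rw [Submodule.mem_bot]
  ext d
  exact hf d (by simp)

lemma regularMod_initialVarsIdeal_X (i : Fin n) :
    RegularMod (initialVarsIdeal W n i) (X i) := by
  intro a ha d hd
  have := ha (Finsupp.single i 1 + d) (fun j hj => by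
    have hji : j ≠ i := fun h => by simp [h] at hj
    simp [hd j hj, Ne.symm hji])
  rwa [X, coeff_add_monomial_mul, one_mul] at this

lemma initialVarsIdeal_succ (i : Fin n) :
    initialVarsIdeal W n (i + 1) = initialVarsIdeal W n i ⊔ Ideal.span {X i} := by
  classical
  apply le_antisymm
  · intro f hf
    let g : MvPowerSeries (Fin n) W := fun d => coeff (d + Finsupp.single i 1) f
    have hg : ∀ d, coeff d g = coeff (d + Finsupp.single i 1) f := fun d => rfl
    refine mem_sup_span_singleton_iff.2 ⟨f - X i * g, ?_, g, by ring⟩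
    intro d hd
    by_cases hdi : d i = 0
    · rw [map_sub, hf d, zero_sub, neg_eq_zero]
      · rw [X, coeff_monomial_mul, if_neg]
        intro h
        have := h i
        simp [hdi] at this
      · intro j hj
        rcases Nat.lt_succ_iff_lt_or_eq.1 hj with h | h
        · exact hd j h
        · rwa [Fin.ext h]
    · have hle : Finsupp.single i 1 ≤ d := by
        rw [Finsupp.single_le_iff]; omega
      rw [map_sub, X, coeff_monomial_mul, if_pos hle, one_mul, hg, tsub_add_cancel_of_le hle,
        sub_self]
  · refine sup_le (fun f hf d hd => hf d fun j hj => hd j (by omega)) ?_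
    rw [Ideal.span_le, Set.singleton_subset_iff]
    intro d hd
    rw [coeff_X, if_neg]
    rintro rfl
    simpa using hd i (by omega)

lemma initialVarsIdeal_le_span {i : ℕ} (hi : i ≤ n) :
    initialVarsIdeal W n i ≤ Ideal.span (Set.range X) := by
  induction i with
  | zero => rw [initialVarsIdeal_zero]; exact bot_le
  | succ i ih =>
    rw [initialVarsIdeal_succ ⟨i, hi⟩]
    refine sup_le (ih (by omega)) ?_
    rw [Ideal.span_le, Set.singleton_subset_iff]
    exact Ideal.subset_span ⟨_, rfl⟩

lemma mem_initialVarsIdeal_self {f : MvPowerSeries (Fin n) W} :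
    f ∈ initialVarsIdeal W n n ↔ constantCoeff f = 0 := by
  rw [← coeff_zero_eq_constantCoeff_apply]
  constructor
  · intro h
    exact h 0 (by simp)
  · intro h d hd
    have : d = 0 := by ext j; exact hd j j.2
    rwa [this]

lemma hasDepth_succ [IsLocalRing W] {ϖ : W} (hϖ : ϖ ∈ maximalIdeal W)
    (hreg : ϖ ∈ nonZeroDivisors W) (k : ℕ) (hk : k ≤ n) :
    HasDepth (maximalIdeal (MvPowerSeries (Fin n) W)) (k + 1) (initialVarsIdeal W n (n - k)) := by
  induction k with
  | zero =>
    refine ⟨C ϖ, ?_, ?_, trivial⟩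
    · rw [mem_maximalIdeal, mem_nonunits_iff, isUnit_iff_constantCoeff]
      simpa using hϖ
    · intro a ha
      rw [Nat.sub_zero, mem_initialVarsIdeal_self] at ha ⊢
      rw [map_mul, constantCoeff_C, mul_comm] at ha
      exact (mul_right_mem_nonZeroDivisors_eq_zero_iff hreg).1 ha
  | succ k ih =>
    have h1 := ih (by omega)
    have h2 : n - k = (⟨n - (k + 1), by omega⟩ : Fin n) + 1 := by simp; omega
    rw [h2, initialVarsIdeal_succ] at h1
    refine ⟨X ⟨n - (k + 1), by omega⟩, ?_, regularMod_initialVarsIdeal_X ⟨n - (k + 1), _⟩, h1⟩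
    rw [mem_maximalIdeal, mem_nonunits_iff, isUnit_iff_constantCoeff]
    simp

lemma coheight_le_succ [IsLocalRing W] [IsNoetherianRing W] {ϖ : W}
    (hϖ : maximalIdeal W = Ideal.span {ϖ}) (P : PrimeSpectrum (MvPowerSeries (Fin n) W)) :
    Order.coheight P ≤ (n + 1 : ℕ) := by
  classical
  have hgen : maximalIdeal (MvPowerSeries (Fin n) W) =
      Ideal.span (insert (C ϖ) (Set.range X)) := by
    apply le_antisymm
    · intro f hf
      rw [mem_maximalIdeal, mem_nonunits_iff, isUnit_iff_constantCoeff] at hf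
      have h1 : constantCoeff f ∈ maximalIdeal W := hf
      rw [hϖ, Ideal.mem_span_singleton'] at h1
      obtain ⟨a, ha⟩ := h1
      have h2 : f - C a * C ϖ ∈ initialVarsIdeal W n n := by
        rw [mem_initialVarsIdeal_self, ← map_mul, ha]
        simp
      have h3 := Ideal.span_mono (Set.subset_insert (C ϖ) _) (initialVarsIdeal_le_span le_rfl h2)
      have h4 : C a * C ϖ ∈ Ideal.span (insert (C ϖ) (Set.range X) :
          Set (MvPowerSeries (Fin n) W)) :=
        Ideal.mul_mem_left _ _ (Ideal.subset_span (Set.mem_insert _ _))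
      simpa using add_mem h3 h4
    · rw [Ideal.span_le]
      rintro f (rfl | ⟨i, rfl⟩)
      · rw [SetLike.mem_coe, mem_maximalIdeal, mem_nonunits_iff, isUnit_iff_constantCoeff]
        have : ϖ ∈ maximalIdeal W := hϖ ▸ Ideal.mem_span_singleton_self ϖ
        simpa using this
      · rw [SetLike.mem_coe, mem_maximalIdeal, mem_nonunits_iff, isUnit_iff_constantCoeff]
        simp
  have hcard : (insert (C ϖ) (Set.range (X : Fin n → MvPowerSeries (Fin n) W))).ncard ≤ n + 1 := by
    refine (Set.ncard_insert_le _ _).trans ?_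
    have := Set.ncard_image_le (f := (X : Fin n → MvPowerSeries (Fin n) W))
      (Set.finite_univ : (Set.univ : Set (Fin n)).Finite)
    rw [Set.image_univ, Set.ncard_univ, Nat.card_fin] at this
    omega
  have hht : (maximalIdeal (MvPowerSeries (Fin n) W)).height ≤ (n + 1 : ℕ) := by
    refine (Ideal.height_le_spanFinrank _ (maximalIdeal.isMaximal _).ne_top).trans ?_
    rw [hgen]
    exact_mod_cast (Submodule.spanFinrank_span_le_ncard_of_finite (Set.toFinite _)).trans hcard
  have h1 := Order.coheight_le_krullDim P
  have h2 : Order.krullDim (PrimeSpectrum (MvPowerSeries (Fin n) W)) =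
      (maximalIdeal (MvPowerSeries (Fin n) W)).height :=
    IsLocalRing.maximalIdeal_height_eq_ringKrullDim.symm
  rw [h2, WithBot.coe_le_coe] at h1
  exact h1.trans hht

end MvPowerSeries

lemma comap_le_comap_iff_of_surjective {R S : Type*} [CommRing R] [CommRing S] {φ : R →+* S}
    (hφ : Function.Surjective φ) {p q : PrimeSpectrum S} :
    PrimeSpectrum.comap φ p ≤ PrimeSpectrum.comap φ q ↔ p ≤ q := by
  change p.asIdeal.comap φ ≤ q.asIdeal.comap φ ↔ p.asIdeal ≤ q.asIdeal
  exact Ideal.comap_le_comap_iff_of_surjective φ hφ _ _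

lemma exists_eq_comap_of_surjective {R S : Type*} [CommRing R] [CommRing S] {φ : R →+* S}
    (hφ : Function.Surjective φ) {p : PrimeSpectrum S} {q : PrimeSpectrum R}
    (h : PrimeSpectrum.comap φ p ≤ q) : ∃ q', p ≤ q' ∧ PrimeSpectrum.comap φ q' = q := by
  have hker : RingHom.ker φ ≤ q.asIdeal := fun x hx => h (by
    change φ x ∈ p.asIdeal
    rw [RingHom.mem_ker.1 hx]
    exact zero_mem _)
  have hq : PrimeSpectrum.comap φ ⟨q.asIdeal.map φ, Ideal.map_isPrime_of_surjective hφ hker⟩ = q := by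
    ext1
    change (q.asIdeal.map φ).comap φ = q.asIdeal
    exact (q.asIdeal.comap_map_of_surjective φ hφ).trans (sup_eq_left.2 hker)
  exact ⟨_, (comap_le_comap_iff_of_surjective hφ).1 (h.trans hq.ge), hq⟩

lemma strictMono_comap_of_surjective {R S : Type*} [CommRing R] [CommRing S] {φ : R →+* S}
    (hφ : Function.Surjective φ) : StrictMono (PrimeSpectrum.comap φ) := fun _ _ h =>
  lt_of_le_not_ge ((comap_le_comap_iff_of_surjective hφ).2 h.le)
    fun h' => h.not_ge ((comap_le_comap_iff_of_surjective hφ).1 h')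

lemma coheight_comap_of_surjective {R S : Type*} [CommRing R] [CommRing S] {φ : R →+* S}
    (hφ : Function.Surjective φ) (p : PrimeSpectrum S) :
    Order.coheight (PrimeSpectrum.comap φ p) = Order.coheight p := by
  refine (Order.coheight_eq_of_strictMono _ (strictMono_comap_of_surjective hφ)
    (fun a b hab => ?_) p).symm
  obtain ⟨a', ha, rfl⟩ := exists_eq_comap_of_surjective hφ hab.le
  exact ⟨a', lt_of_le_of_ne ha (by rintro rfl; exact lt_irrefl _ hab), rfl⟩

lemma comap_covBy_of_surjective {R S : Type*} [CommRing R] [CommRing S] {φ : R →+* S}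
    (hφ : Function.Surjective φ) {p q : PrimeSpectrum S} (h : p ⋖ q) :
    PrimeSpectrum.comap φ p ⋖ PrimeSpectrum.comap φ q := by
  refine ⟨strictMono_comap_of_surjective hφ h.lt, fun c hc hc' => ?_⟩
  obtain ⟨c, hpc, rfl⟩ := exists_eq_comap_of_surjective hφ hc.le
  exact h.2 (lt_of_le_of_ne hpc (by rintro rfl; exact lt_irrefl _ hc))
    (lt_of_le_of_ne ((comap_le_comap_iff_of_surjective hφ).1 hc'.le)
      (by rintro rfl; exact lt_irrefl _ hc'))

/-- Covering primes in a complete Noetherian local ring having a coefficient ring have coheights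
differing by one. -/
theorem coheight_eq_of_coefficientRing {W T : Type*} [CommRing W] [IsLocalRing W]
    [IsNoetherianRing W] [CommRing T] [IsLocalRing T] [IsNoetherianRing T]
    [IsAdicComplete (maximalIdeal T) T] {ϖ : W} (hϖ : maximalIdeal W = Ideal.span {ϖ})
    (hreg : ϖ ∈ nonZeroDivisors W) (g : W →+* T) (hg : ∀ t, ∃ w, t - g w ∈ maximalIdeal T)
    {p q : PrimeSpectrum T} (hpq : p ⋖ q) : Order.coheight p = Order.coheight q + 1 := by
  obtain ⟨n, t, ht⟩ := Submodule.fg_iff_exists_fin_generating_family.1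
    (IsNoetherian.noetherian (maximalIdeal T))
  obtain ⟨φ, hφC, hφX⟩ := exists_ringHom_mvPowerSeries (maximalIdeal T) g t
    (fun i => ht ▸ Submodule.subset_span ⟨i, rfl⟩)
  have hmap : (Ideal.span (Set.range MvPowerSeries.X)).map φ = maximalIdeal T := by
    rw [Ideal.map_span, ← Set.range_comp, ← ht]
    congr 2
    ext i
    exact hφX i
  have : IsHausdorff ((Ideal.span (Set.range MvPowerSeries.X)).map φ) T := by
    rw [hmap]; infer_instance
  have hsurj : Function.Surjective φ := by
    refine surjective_of_isPrecomplete φ (Ideal.span (Set.range MvPowerSeries.X)) fun s => ?_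
    obtain ⟨w, hw⟩ := hg s
    refine ⟨MvPowerSeries.C w, ?_⟩
    rwa [hmap, hφC]
  have hdep : HasDepth (maximalIdeal (MvPowerSeries (Fin n) W)) (n + 1) ⊥ := by
    have := MvPowerSeries.hasDepth_succ (n := n) (hϖ ▸ Ideal.mem_span_singleton_self ϖ) hreg n
      le_rfl
    rwa [Nat.sub_self, MvPowerSeries.initialVarsIdeal_zero] at this
  rw [← coheight_comap_of_surjective hsurj, ← coheight_comap_of_surjective hsurj]
  refine coheight_eq_of_hasDepth hdep (MvPowerSeries.coheight_le_succ hϖ)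
    (comap_covBy_of_surjective hsurj hpq)

end PowerSeries

/-! ### Formal smoothness of fields of characteristic `p` -/

/-- A subring of a product that is injected into the field `k`, contains the `p`-th powers of a
subring `D` surjecting onto `k`, and is maximal among such subrings of `D`, surjects onto `k`. -/
lemma exists_subring_bijective_fst {p : ℕ} [Fact p.Prime] {k B : Type*} [Field k] [CharP k p]
    [CommRing B] (hB : (p : B) = 0) (D : Subring (k × B)) (hD : ∀ x, ∃ b, (x, b) ∈ D)
    (hD0 : ∀ b, ((0 : k), b) ∈ D → b ^ p = 0) :
    ∃ G ≤ D, (∀ b, ((0 : k), b) ∈ G → b = 0) ∧ ∀ x, ∃ b, (x, b) ∈ G := by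
  have hp : p.Prime := Fact.out
  have : CharP (k × B) p := by
    rw [CharP.charP_iff_prime_eq_zero hp]
    ext <;> simp [hB]
  let S : Set (Subring (k × B)) :=
    {G | G ≤ D ∧ D.map (frobenius (k × B) p) ≤ G ∧ ∀ b, ((0 : k), b) ∈ G → b = 0}
  have hS0 : D.map (frobenius (k × B) p) ∈ S := by
    refine ⟨?_, le_rfl, ?_⟩
    · rintro _ ⟨d, hd, rfl⟩
      exact pow_mem hd p
    · rintro b ⟨⟨x, c⟩, hd, h⟩
      simp only [frobenius_def, Prod.pow_mk, Prod.mk.injEq] at h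
      obtain rfl : x = 0 := eq_zero_of_pow_eq_zero h.1
      rw [← h.2]
      exact hD0 c hd
  obtain ⟨G, -, hG, hmax⟩ := zorn_le_nonempty₀ S (fun c hcS hc y hy ↦ by
    have hdir : DirectedOn (· ≤ ·) c := hc.directedOn
    refine ⟨sSup c, ⟨sSup_le fun G hG ↦ (hcS hG).1, (hcS hy).2.1.trans (le_sSup hy), ?_⟩,
      fun z hz ↦ le_sSup hz⟩
    intro b hb
    obtain ⟨G, hG, hbG⟩ := (Subring.mem_sSup_of_directedOn ⟨y, hy⟩ hdir).mp hb
    exact (hcS hG).2.2 b hbG) _ hS0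
  refine ⟨G, hG.1, hG.2.2, fun x ↦ ?_⟩
  by_contra! hx
  have hpow (d : k × B) (hd : d ∈ D) : d ^ p ∈ G := hG.2.1 ⟨d, hd, rfl⟩
  have hinj (g : G) (h : g.1.1 = 0) : g = 0 := by
    obtain ⟨⟨y, b⟩, hg⟩ := g
    obtain rfl : y = 0 := h
    obtain rfl := hG.2.2 b hg
    rfl
  have hfield : IsField G := by
    refine ⟨⟨0, 1, fun h ↦ ?_⟩, mul_comm, fun {g} hg ↦ ?_⟩
    · simpa using congr(($h).1.1)
    · have hg0 : g.1.1 ≠ 0 := fun h ↦ hg (hinj g h)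
      obtain ⟨c, hc⟩ := hD g.1.1⁻¹
      refine ⟨g ^ (p - 1) * ⟨_, hpow _ hc⟩, ?_⟩
      rw [← mul_assoc, mul_pow_sub_one hp.ne_zero, ← sub_eq_zero]
      apply hinj
      simp [hg0]
  let : Field G := hfield.toField
  obtain ⟨b, hb⟩ := hD x
  let φ : G →+* k := (RingHom.fst k B).comp G.subtype
  let : Algebra G k := φ.toAlgebra
  let c : G := ⟨(x, b) ^ p, hpow _ hb⟩
  have hirr : Irreducible (Polynomial.X ^ p - Polynomial.C c : Polynomial G) := by
    refine X_pow_sub_C_irreducible_of_prime hp fun g hg ↦ ?_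
    have h1 : g.1.1 ^ p = x ^ p := congr(($hg).1.1)
    have h2 : g.1.1 = x := frobenius_inj k p h1
    exact hx g.1.2 (h2 ▸ g.2)
  have hmin : Polynomial.X ^ p - Polynomial.C c = minpoly G x := by
    refine minpoly.eq_of_irreducible_of_monic hirr ?_ (Polynomial.monic_X_pow_sub_C _ hp.ne_zero)
    simp only [map_sub, map_pow, Polynomial.aeval_X, Polynomial.aeval_C]
    exact sub_self (x ^ p)
  let ev : Polynomial G →+* k × B := Polynomial.eval₂RingHom G.subtype (x, b)
  have hev (f : Polynomial G) : (ev f).1 = Polynomial.aeval x f := by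
    have : (RingHom.fst k B).comp ev = (Polynomial.aeval x : Polynomial G →ₐ[G] k).toRingHom := by
      ext g
      · simp [ev]; rfl
      · simp [ev]
    exact congr($this f)
  have hle : G ≤ ev.range := fun g hg ↦ ⟨Polynomial.C ⟨g, hg⟩, by simp [ev]⟩
  have hmem : ev.range ∈ S := by
    refine ⟨?_, hG.2.1.trans hle, ?_⟩
    · rintro _ ⟨f, rfl⟩
      induction f using Polynomial.induction_on' with
      | add f g hf hg => rw [map_add]; exact add_mem hf hg
      | monomial n a =>
        simp only [ev, Polynomial.coe_eval₂RingHom, Polynomial.eval₂_monomial]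
        exact mul_mem (hG.1 a.2) (pow_mem hb n)
    · rintro e ⟨f, hf⟩
      have h0 : Polynomial.aeval x f = 0 := by rw [← hev, hf]
      obtain ⟨h, rfl⟩ := minpoly.dvd G x h0
      have : ev (minpoly G x) = 0 := by
        rw [← hmin]
        simp [ev, c]
      rw [map_mul, this, zero_mul] at hf
      exact congr(($hf).2).symm
  have := hmax hmem hle
  exact hx b (this ⟨Polynomial.X, by simp [ev]⟩)

/-- Ring homomorphisms from a field of characteristic `p` lift along square-zero extensions of
rings of characteristic `p`. -/
lemma exists_ringHom_lift_of_sq_eq_bot {p : ℕ} [Fact p.Prime] {k B : Type*} [Field k] [CharP k p]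
    [CommRing B] (hB : (p : B) = 0) (I : Ideal B) (hI : I ^ 2 = ⊥) (φ : k →+* B ⧸ I) :
    ∃ ψ : k →+* B, (Ideal.Quotient.mk I).comp ψ = φ := by
  have hp : p.Prime := Fact.out
  let D : Subring (k × B) := (φ.comp (RingHom.fst k B)).eqLocus
    ((Ideal.Quotient.mk I).comp (RingHom.snd k B))
  obtain ⟨G, hGD, h0, h1⟩ := exists_subring_bijective_fst (p := p) hB D
    (fun x ↦ by
      obtain ⟨b, hb⟩ := Ideal.Quotient.mk_surjective (φ x)
      exact ⟨b, hb.symm⟩)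
    (fun b hb ↦ by
      have hb' : φ 0 = Ideal.Quotient.mk I b := hb
      rw [map_zero, eq_comm, Ideal.Quotient.eq_zero_iff_mem] at hb'
      have : b ^ p ∈ I ^ 2 := Ideal.pow_le_pow_right hp.two_le (Ideal.pow_mem_pow hb' p)
      rwa [hI] at this)
  let π : G →+* k := (RingHom.fst k B).comp G.subtype
  have hπ : Function.Bijective π := by
    refine ⟨(injective_iff_map_eq_zero π).mpr ?_, fun x ↦ ?_⟩
    · rintro ⟨⟨y, b⟩, hg⟩ h
      obtain rfl : y = 0 := h
      obtain rfl := h0 b hg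
      rfl
    · obtain ⟨b, hb⟩ := h1 x
      exact ⟨⟨_, hb⟩, rfl⟩
  let e := RingEquiv.ofBijective π hπ
  refine ⟨((RingHom.snd k B).comp G.subtype).comp e.symm.toRingHom, ?_⟩
  ext x
  obtain ⟨g, rfl⟩ := e.surjective x
  have hg : φ g.1.1 = Ideal.Quotient.mk I g.1.2 := hGD g.2
  simpa using! hg.symm

/-! ### Cohen rings -/

/-- If monic polynomials over `R` have roots, then roots of a reduction of a monic polynomial
lift to roots of the polynomial. -/
lemma exists_isRoot_of_isRoot_map {R κ : Type*} [CommRing R] [CommRing κ] [IsDomain κ]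
    (hR : ∀ f : Polynomial R, f.Monic → f.natDegree ≠ 0 → ∃ t, f.IsRoot t) (res : R →+* κ)
    (f : Polynomial R) (hf : f.Monic) (β : κ) (hβ : (f.map res).IsRoot β) :
    ∃ t, f.IsRoot t ∧ res t = β := by
  have : Nontrivial R := res.domain_nontrivial
  induction hn : f.natDegree generalizing f with
  | zero =>
    obtain rfl : f = 1 := hf.natDegree_eq_zero.mp hn
    simp at hβ
  | succ n ih =>
    obtain ⟨t, ht⟩ := hR f hf (by lia)
    obtain ⟨g, rfl⟩ := Polynomial.dvd_iff_isRoot.mpr ht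
    have hg : g.Monic := (Polynomial.monic_X_sub_C t).of_mul_monic_left hf
    by_cases h : res t = β
    · exact ⟨t, ht, h⟩
    · have hβ' : (β - res t) * (g.map res).eval β = 0 := by simpa using hβ
      obtain ⟨s, hs, hsβ⟩ := ih g hg
        ((mul_eq_zero.mp hβ').resolve_left (sub_ne_zero.mpr (Ne.symm h))) (by
          rw [(Polynomial.monic_X_sub_C t).natDegree_mul hg, Polynomial.natDegree_X_sub_C] at hn
          lia)
      exact ⟨s, Polynomial.root_mul_left_of_isRoot _ hs, hsβ⟩

/-- A local ring `O` in which monic polynomials have roots contains a local subring with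
maximal ideal `(p)` and prescribed residue field. -/
lemma exists_subring_map_eq_range {p : ℕ} [Fact p.Prime] {k O κ : Type*} [Field k] [Field κ]
    [CommRing O] (hroot : ∀ f : Polynomial O, f.Monic → f.natDegree ≠ 0 → ∃ t, f.IsRoot t)
    (res : O →+* κ) [IsLocalHom res] (hres : Function.Surjective res)
    (j : k →+* κ) (hp : res p = 0) :
    ∃ Λ : Subring O, Λ.map res = j.range ∧ (∀ x ∈ Λ, res x = 0 → ∃ y ∈ Λ, x = p * y) ∧
      ∀ x ∈ Λ, res x ≠ 0 → ∃ y ∈ Λ, x * y = 1 := by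
  have : CharP κ p := by
    rw [CharP.charP_iff_prime_eq_zero Fact.out]
    simpa using hp
  let S : Set (Subring O) :=
    {Λ | Λ.map res ≤ j.range ∧ ∀ x ∈ Λ, res x = 0 → ∃ y ∈ Λ, x = p * y}
  have hS0 : (Int.castRingHom O).range ∈ S := by
    refine ⟨?_, ?_⟩
    · rintro _ ⟨_, ⟨n, rfl⟩, rfl⟩
      exact ⟨n, by simp⟩
    · rintro _ ⟨n, rfl⟩ h
      obtain ⟨m, rfl⟩ : (p : ℤ) ∣ n := by
        rw [← CharP.intCast_eq_zero_iff κ p]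
        simpa using h
      exact ⟨m, ⟨m, by simp⟩, by simp⟩
  obtain ⟨Λ, -, hΛ, hmax⟩ := zorn_le_nonempty₀ S (fun c hcS hc y hy ↦ by
    have hdir : DirectedOn (· ≤ ·) c := hc.directedOn
    refine ⟨sSup c, ⟨?_, ?_⟩, fun z hz ↦ le_sSup hz⟩
    · rintro _ ⟨x, hx, rfl⟩
      obtain ⟨G, hG, hxG⟩ := (Subring.mem_sSup_of_directedOn ⟨y, hy⟩ hdir).mp hx
      exact (hcS hG).1 ⟨x, hxG, rfl⟩
    · intro x hx h
      obtain ⟨G, hG, hxG⟩ := (Subring.mem_sSup_of_directedOn ⟨y, hy⟩ hdir).mp hx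
      obtain ⟨y, hy, rfl⟩ := (hcS hG).2 x hxG h
      exact ⟨y, le_sSup hG hy, rfl⟩) _ hS0
  have hinv : ∀ x ∈ Λ, res x ≠ 0 → ∃ y ∈ Λ, x * y = 1 := by
    let Λ' : Subring O :=
      { carrier := {y | ∃ s ∈ Λ, res s ≠ 0 ∧ s * y ∈ Λ}
        mul_mem' := by
          rintro a b ⟨s, hs, hs0, hsa⟩ ⟨t, ht, ht0, htb⟩
          refine ⟨s * t, mul_mem hs ht, by simp [hs0, ht0], ?_⟩
          rw [mul_mul_mul_comm]
          exact mul_mem hsa htb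
        one_mem' := ⟨1, one_mem _, by simp, by simp [one_mem]⟩
        add_mem' := by
          rintro a b ⟨s, hs, hs0, hsa⟩ ⟨t, ht, ht0, htb⟩
          refine ⟨s * t, mul_mem hs ht, by simp [hs0, ht0], ?_⟩
          have : s * t * (a + b) = t * (s * a) + s * (t * b) := by ring
          rw [this]
          exact add_mem (mul_mem ht hsa) (mul_mem hs htb)
        zero_mem' := ⟨1, one_mem _, by simp, by simp [zero_mem]⟩
        neg_mem' := by
          rintro a ⟨s, hs, hs0, hsa⟩
          exact ⟨s, hs, hs0, by simpa using hsa⟩ }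
    have hle : Λ ≤ Λ' := fun x hx ↦ ⟨1, one_mem _, by simp, by simpa using hx⟩
    have hmem : Λ' ∈ S := by
      refine ⟨?_, ?_⟩
      · rintro _ ⟨y, ⟨s, hs, hs0, hsy⟩, rfl⟩
        obtain ⟨a, ha⟩ := hΛ.1 ⟨s, hs, rfl⟩
        obtain ⟨b, hb⟩ := hΛ.1 ⟨_, hsy, rfl⟩
        refine ⟨b / a, ?_⟩
        rw [map_div₀, ha, hb, map_mul, mul_div_cancel_left₀ _ hs0]
      · rintro y ⟨s, hs, hs0, hsy⟩ hy
        obtain ⟨z, hz, hyz⟩ := hΛ.2 _ hsy (by simp [hy])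
        obtain ⟨u, rfl⟩ := isUnit_of_map_unit res s (isUnit_iff_ne_zero.mpr hs0)
        exact ⟨↑u⁻¹ * z, ⟨u, hs, hs0, by simpa using hz⟩,
          by rw [mul_left_comm, ← hyz, Units.inv_mul_cancel_left]⟩
    intro x hx hx0
    obtain ⟨u, rfl⟩ := isUnit_of_map_unit res x (isUnit_iff_ne_zero.mpr hx0)
    exact ⟨↑u⁻¹, hmax hmem hle ⟨u, hx, hx0, by simp [one_mem]⟩, by simp⟩
  refine ⟨Λ, le_antisymm hΛ.1 ?_, hΛ.2, hinv⟩
  rintro _ ⟨α, rfl⟩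
  let E : Subfield κ :=
    { Λ.map res with
      inv_mem' := by
        rintro _ ⟨x, hx, rfl⟩
        by_cases h0 : res x = 0
        · exact ⟨0, zero_mem Λ, by simp [h0]⟩
        · obtain ⟨y, hy, hxy⟩ := hinv x hx h0
          refine ⟨y, hy, ?_⟩
          rw [eq_comm, inv_eq_iff_eq_inv]
          exact eq_inv_of_mul_eq_one_left (by rw [← map_mul, hxy, map_one]) }
  let r : Λ →+* E := (res.comp Λ.subtype).codRestrict E (fun x ↦ ⟨x, x.2, rfl⟩)
  have hr : Function.Surjective r := by
    rintro ⟨_, x, hx, rfl⟩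
    exact ⟨⟨x, hx⟩, rfl⟩
  have hcomp : (algebraMap E κ).comp r = res.comp Λ.subtype := rfl
  -- a monic polynomial (or zero) over `Λ` lifting the minimal polynomial, and a lift of its root
  obtain ⟨f, t, ht, hft, hf⟩ : ∃ (f : Polynomial Λ) (t : O), res t = j α ∧
      f.eval₂ Λ.subtype t = 0 ∧ ∀ g : Polynomial Λ, (g.map r).aeval (j α) = 0 →
        ∃ q h : Polynomial Λ, g = f * q + h ∧ h.map r = 0 := by
    by_cases hInt : IsIntegral E (j α)
    · obtain ⟨f, hfr, hdeg, hfm⟩ := Polynomial.lifts_and_natDegree_eq_and_monic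
        (Polynomial.map_surjective r hr (minpoly E (j α))) (minpoly.monic hInt)
      obtain ⟨t, ht, htα⟩ := exists_isRoot_of_isRoot_map hroot res (f.map Λ.subtype)
        (hfm.map _) (j α) (by
          rw [Polynomial.map_map, ← hcomp, ← Polynomial.map_map, hfr, Polynomial.IsRoot,
            Polynomial.eval_map_algebraMap]
          exact minpoly.aeval E _)
      refine ⟨f, t, htα, by simpa [Polynomial.eval_map] using ht, fun g hg ↦ ?_⟩
      refine ⟨g /ₘ f, g %ₘ f, by rw [add_comm, Polynomial.modByMonic_add_div], ?_⟩
      by_contra h0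
      have hdvd : minpoly E (j α) ∣ (g %ₘ f).map r := by
        apply minpoly.dvd
        rw [Polynomial.modByMonic_eq_sub_mul_div g f, Polynomial.map_sub, Polynomial.map_mul, hfr]
        simp [hg]
      refine (Polynomial.degree_le_of_dvd hdvd h0).not_gt ?_
      rw [← hfr, Polynomial.map_modByMonic _ hfm]
      exact Polynomial.degree_modByMonic_lt _ (hfm.map r)
    · obtain ⟨t, ht⟩ := hres (j α)
      refine ⟨0, t, ht, by simp, fun g hg ↦ ⟨0, g, by simp, ?_⟩⟩
      by_contra h0
      exact hInt (IsAlgebraic.isIntegral ⟨_, h0, hg⟩)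
  let ev : Polynomial Λ →+* O := Polynomial.eval₂RingHom Λ.subtype t
  have hev (g : Polynomial Λ) : res (ev g) = (g.map r).aeval (j α) := by
    rw [← ht, Polynomial.aeval_def, Polynomial.eval₂_map, hcomp, ← Polynomial.hom_eval₂]
    rfl
  have hle : Λ ≤ ev.range := fun g hg ↦ ⟨Polynomial.C ⟨g, hg⟩, by simp [ev]⟩
  have hmem : ev.range ∈ S := by
    refine ⟨?_, ?_⟩
    · rintro _ ⟨_, ⟨g, rfl⟩, rfl⟩
      induction g using Polynomial.induction_on' with
      | add g h hg hh => simpa using add_mem hg hh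
      | monomial n a =>
        have := mul_mem (hΛ.1 ⟨a, a.2, rfl⟩) (pow_mem (⟨α, ht.symm⟩ : res t ∈ j.range) n)
        simpa [ev] using this
    · rintro _ ⟨g, rfl⟩ hg
      rw [hev] at hg
      obtain ⟨q, h, rfl, hh⟩ := hf g hg
      have hfe : ev f = 0 := hft
      have hev' : ev (f * q + h) = ev h := by rw [map_add, map_mul, hfe, zero_mul, zero_add]
      have hcoef (n : ℕ) : ∃ y : Λ, h.coeff n = p * y := by
        have : r (h.coeff n) = 0 := by rw [← Polynomial.coeff_map, hh, Polynomial.coeff_zero]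
        obtain ⟨y, hy, hxy⟩ := hΛ.2 _ (h.coeff n).2 congr(($this).1)
        exact ⟨⟨y, hy⟩, Subtype.ext (by simpa using hxy)⟩
      have hdvd : Polynomial.C (p : Λ) ∣ h := by
        rw [Polynomial.C_dvd_iff_dvd_coeff]
        exact fun n ↦ hcoef n
      obtain ⟨h', rfl⟩ := hdvd
      exact ⟨ev h', ⟨h', rfl⟩, by rw [hev', map_mul]; simp [ev]⟩
  exact ⟨t, hmax hmem hle ⟨Polynomial.X, by simp [ev]⟩, ht⟩

/-- A domain in which the elements outside of the prime ideal `(ϖ)` are units has a Noetherian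
local quotient in which `ϖ` is a nonzerodivisor. -/
lemma exists_isNoetherianRing_of_ker_eq_span {Λ k : Type*} [CommRing Λ] [IsDomain Λ] [Field k]
    (r : Λ →+* k) [IsLocalHom r] (hr : Function.Surjective r) {ϖ : Λ} (hϖ : ϖ ≠ 0)
    (hker : RingHom.ker r = Ideal.span {ϖ}) :
    ∃ (J : Ideal Λ) (hJ : J ≤ RingHom.ker r), IsLocalRing (Λ ⧸ J) ∧ IsNoetherianRing (Λ ⧸ J) ∧
      Ideal.Quotient.mk J ϖ ∈ nonZeroDivisors (Λ ⧸ J) ∧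
      RingHom.ker (Ideal.Quotient.lift J r hJ) = Ideal.span {Ideal.Quotient.mk J ϖ} := by
  let J : Ideal Λ := ⨅ n : ℕ, Ideal.span {ϖ ^ n}
  have hmem {x : Λ} : x ∈ J ↔ ∀ n : ℕ, ϖ ^ n ∣ x := by
    simp [J, Ideal.mem_span_singleton]
  have hJ : J ≤ RingHom.ker r := by
    rw [hker]
    exact (iInf_le _ 1).trans (by simp)
  have hlocal : IsLocalRing Λ := RingHom.domain_isLocalRing r
  have hnt : Nontrivial (Λ ⧸ J) := (Ideal.Quotient.lift J r hJ).domain_nontrivial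
  have hloc : IsLocalRing (Λ ⧸ J) := .of_surjective' _ Ideal.Quotient.mk_surjective
  have hmax : maximalIdeal Λ = Ideal.span {ϖ} := by
    rw [← hker]
    exact (eq_maximalIdeal (RingHom.ker_isMaximal_of_surjective r hr)).symm
  -- nonzero elements of the quotient are powers of `ϖ` up to units
  have hfact (x : Λ) (hx : x ∉ J) : ∃ n u, IsUnit u ∧ x = ϖ ^ n * u := by
    rw [hmem] at hx
    push Not at hx
    classical
    obtain ⟨n, hn⟩ : ∃ n, Nat.find hx = n + 1 := by
      refine Nat.exists_eq_succ_of_ne_zero fun h ↦ ?_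
      have := Nat.find_spec hx
      rw [h] at this
      simp at this
    obtain ⟨u, rfl⟩ : ϖ ^ n ∣ x := by
      by_contra h
      exact Nat.find_min hx (m := n) (by lia) h
    refine ⟨n, u, ?_, rfl⟩
    by_contra hu
    obtain ⟨v, rfl⟩ : ϖ ∣ u := by
      rw [← Ideal.mem_span_singleton, ← hmax]
      exact (mem_maximalIdeal u).mpr hu
    refine Nat.find_spec hx ?_
    rw [hn]
    exact ⟨v, by ring⟩
  refine ⟨J, hJ, hloc, ?_, ?_, ?_⟩
  · refine IsNoetherianRing.of_prime fun P hP ↦ ?_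
    by_cases hPϖ : Ideal.Quotient.mk J ϖ ∈ P
    · have : P = Ideal.span {Ideal.Quotient.mk J ϖ} := by
        refine le_antisymm (fun x hx ↦ ?_) (by simpa [Ideal.span_le] using hPϖ)
        obtain ⟨x, rfl⟩ := Ideal.Quotient.mk_surjective x
        have : x ∈ Ideal.span {ϖ} := by
          rw [← hmax]
          exact fun hu ↦ hP.ne_top (Ideal.eq_top_of_isUnit_mem _ hx (hu.map _))
        have := Ideal.mem_map_of_mem (Ideal.Quotient.mk J) this
        rwa [Ideal.map_span, Set.image_singleton] at this
      rw [this]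
      exact Submodule.fg_span_singleton _
    · have : P = ⊥ := by
        refine eq_bot_iff.mpr fun x hx ↦ ?_
        obtain ⟨x, rfl⟩ := Ideal.Quotient.mk_surjective x
        by_contra h0
        obtain ⟨n, u, hu, rfl⟩ := hfact x
          (fun h ↦ h0 (Ideal.mem_bot.mpr (Ideal.Quotient.eq_zero_iff_mem.mpr h)))
        rw [map_mul, map_pow] at hx
        rcases hP.mem_or_mem hx with h | h
        · exact hPϖ (hP.mem_of_pow_mem _ h)
        · exact hP.ne_top (Ideal.eq_top_of_isUnit_mem _ h (hu.map _))
      rw [this]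
      exact Submodule.fg_bot
  · rw [mem_nonZeroDivisors_iff_right]
    intro x hx
    obtain ⟨x, rfl⟩ := Ideal.Quotient.mk_surjective x
    rw [← map_mul, Ideal.Quotient.eq_zero_iff_mem, hmem] at hx
    rw [Ideal.Quotient.eq_zero_iff_mem, hmem]
    intro n
    have := hx (n + 1)
    rwa [pow_succ, mul_dvd_mul_iff_right hϖ] at this
  · rw [Ideal.ker_quotient_lift, hker, Ideal.map_span, Set.image_singleton]

/-- Existence of Cohen rings. -/
lemma exists_cohenRing.{u} (p : ℕ) [Fact p.Prime] (k : Type u) [Field k] [CharP k p] :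
    ∃ (W : Type u) (_ : CommRing W) (_ : IsLocalRing W) (_ : IsNoetherianRing W) (r : W →+* k),
      (p : W) ∈ nonZeroDivisors W ∧ Function.Surjective r ∧
      RingHom.ker r = Ideal.span {(p : W)} := by
  let K := AlgebraicClosure k
  let V := WittVector p K
  let Ω := AlgebraicClosure (FractionRing V)
  have hpV : (p : V) ≠ 0 := WittVector.p_nonzero p K
  obtain ⟨O, hO, hloc⟩ := IsLocalRing.exists_factor_valuationRing (algebraMap V Ω)
  let i : V →+* O := (algebraMap V Ω).codRestrict O.toSubring hO
  have hi : IsLocalHom i := hloc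
  have hc : Function.Surjective (WittVector.constantCoeff : V →+* K) :=
    WittVector.constantCoeff_surjective p
  have hker : RingHom.ker (WittVector.constantCoeff : V →+* K) ≤
      RingHom.ker ((residue O).comp i) := by
    intro x hx
    rw [eq_maximalIdeal (RingHom.ker_isMaximal_of_surjective _ hc)] at hx
    rw [RingHom.mem_ker, RingHom.comp_apply, residue_eq_zero_iff]
    exact fun hu ↦ hx (isUnit_of_map_unit i x hu)
  let j : K →+* ResidueField O := RingHom.liftOfSurjective _ hc ⟨_, hker⟩
  have : CharP K p := inferInstanceAs (CharP (AlgebraicClosure k) p)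
  have hp0 : residue O p = 0 := by
    rw [map_natCast, ← map_natCast j, CharP.cast_eq_zero, map_zero]
  have hroot (f : Polynomial O) (hf : f.Monic) (hn : f.natDegree ≠ 0) : ∃ t, f.IsRoot t := by
    obtain ⟨t, ht⟩ := IsAlgClosed.exists_root (f.map O.subtype) (by
      rw [hf.degree_map]
      exact fun h ↦ hn (Polynomial.natDegree_eq_of_degree_eq_some h))
    have ht' : IsIntegral O t := ⟨f, hf, by simpa [Polynomial.eval_map] using! ht⟩
    obtain ⟨t, rfl⟩ := IsIntegrallyClosed.isIntegral_iff.mp ht'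
    refine ⟨t, FaithfulSMul.algebraMap_injective O Ω ?_⟩
    rw [map_zero, ← Polynomial.eval₂_at_apply, ← Polynomial.eval_map]
    exact ht
  obtain ⟨Λ, h1, h2, h3⟩ := exists_subring_map_eq_range (p := p) hroot (residue O)
    residue_surjective (j.comp (algebraMap k K)) hp0
  set ψ : k →+* ResidueField O := j.comp (algebraMap k K)
  have hψ : Function.Injective ψ := RingHom.injective _
  let e : k ≃+* ψ.range := RingEquiv.ofBijective ψ.rangeRestrict
    ⟨fun x y h ↦ hψ congr(($h).1), ψ.rangeRestrict_surjective⟩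
  obtain ⟨r, hrψ⟩ : ∃ r : Λ →+* k, ∀ x : Λ, ψ (r x) = residue O x := by
    refine ⟨e.symm.toRingHom.comp
      (((residue O).comp Λ.subtype).codRestrict ψ.range fun x ↦ h1.le ⟨x, x.2, rfl⟩), fun x ↦ ?_⟩
    exact congr(($(e.apply_symm_apply
      ⟨residue O x, h1.le ⟨x, x.2, rfl⟩⟩)).1)
  have hr0 (x : Λ) : r x = 0 ↔ residue O x = 0 := by
    rw [← hrψ, map_eq_zero ψ]
  have hr : Function.Surjective r := by
    intro y
    obtain ⟨x, hx, hxy⟩ := h1.ge ⟨y, rfl⟩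
    exact ⟨⟨x, hx⟩, hψ ((hrψ _).trans hxy)⟩
  have hrloc : IsLocalHom r := ⟨fun x hx ↦ by
    obtain ⟨y, hy, hxy⟩ := h3 x x.2 (fun h ↦ hx.ne_zero ((hr0 x).mpr h))
    exact .of_mul_eq_one ⟨y, hy⟩ (Subtype.ext hxy)⟩
  have hpO : (p : Λ) ≠ 0 := by
    intro h
    have hinj : Function.Injective (algebraMap V Ω) := by
      rw [IsScalarTower.algebraMap_eq V (FractionRing V) Ω]
      exact (algebraMap (FractionRing V) Ω).injective.comp (IsFractionRing.injective V _)
    refine hpV (hinj ?_)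
    rw [map_zero]
    exact (map_natCast (algebraMap V Ω) p).trans congr((($h).1.1))
  have hkr : RingHom.ker r = Ideal.span {(p : Λ)} := by
    ext x
    rw [RingHom.mem_ker, hr0, Ideal.mem_span_singleton]
    refine ⟨fun h ↦ ?_, ?_⟩
    · obtain ⟨y, hy, hxy⟩ := h2 x x.2 h
      exact ⟨⟨y, hy⟩, Subtype.ext (by simpa using hxy)⟩
    · rintro ⟨y, rfl⟩
      simp at hp0 ⊢
      simp [hp0]
  obtain ⟨J, hJ, hW1, hW2, hW3, hW4⟩ := exists_isNoetherianRing_of_ker_eq_span r hr hpO hkr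
  refine ⟨Λ ⧸ J, inferInstance, hW1, hW2, Ideal.Quotient.lift J r hJ, by simpa using hW3,
    Ideal.Quotient.lift_surjective_of_surjective J hJ hr, by simpa using hW4⟩

/-! ### Lifting homomorphisms from Cohen rings -/

lemma formallySmooth_quotient_of_le {R S : Type*} [CommRing R] [CommRing S] [Algebra R S]
    [Module.Flat R S] {I J : Ideal R} (hJI : J ≤ I) (hIJ : I ^ 2 ≤ J)
    (h : Algebra.FormallySmooth (R ⧸ I) (S ⧸ I.map (algebraMap R S))) :
    Algebra.FormallySmooth (R ⧸ J) (S ⧸ J.map (algebraMap R S)) := by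
  have hflat : Module.Flat (R ⧸ J) (S ⧸ J.map (algebraMap R S)) :=
    .of_linearEquiv (Algebra.TensorProduct.quotIdealMapEquivQuotTensor S J).toLinearEquiv
  rw [← RingHom.formallySmooth_algebraMap] at h ⊢
  have hmk : (algebraMap (R ⧸ J) (S ⧸ J.map (algebraMap R S))).comp (Ideal.Quotient.mk J) =
      (Ideal.Quotient.mk (J.map (algebraMap R S))).comp (algebraMap R S) := rfl
  refine RingHom.FormallySmooth.of_flat_of_ker_eq_map_of_square_zero _
    ((RingHom.flat_algebraMap_iff).mpr hflat) (Ideal.Quotient.factor hJI)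
    (Ideal.Quotient.factor (Ideal.map_mono hJI)) _ (Ideal.Quotient.factor_surjective _)
    (Ideal.Quotient.factor_surjective _) ?_ ?_ ?_ h
  · ext x; rfl
  · rw [Ideal.Quotient.factor_ker, ← Ideal.map_pow, Ideal.map_eq_bot_iff_le_ker, Ideal.mk_ker]
    exact hIJ
  · rw [Ideal.Quotient.factor_ker, Ideal.Quotient.factor_ker, Ideal.map_map, Ideal.map_map, hmk]

/-- Homomorphisms from a Cohen ring lift along square-zero extensions of rings killed by a
power of `p`. -/
lemma exists_ringHom_lift_of_ker_eq_span {p : ℕ} [Fact p.Prime] {W k : Type} [CommRing W]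
    [IsLocalRing W] [Field k] [CharP k p] (hp : (p : W) ∈ nonZeroDivisors W) (r : W →+* k)
    (hr : Function.Surjective r) (hker : RingHom.ker r = Ideal.span {(p : W)}) (n : ℕ) {B : Type}
    [CommRing B] (hB : (p : B) ^ (n + 1) = 0) (I : Ideal B) (hI : I ^ 2 = ⊥) (φ : W →+* B ⧸ I) :
    ∃ ψ : W →+* B, (Ideal.Quotient.mk I).comp ψ = φ := by
  have hunit (z : ℤ) (hz : ¬ (p : ℤ) ∣ z) : IsUnit (z : W) := by
    by_contra h
    have hm : (z : W) ∈ RingHom.ker r := by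
      rw [eq_maximalIdeal (RingHom.ker_isMaximal_of_surjective r hr)]
      exact (mem_maximalIdeal _).mpr h
    rw [RingHom.mem_ker, map_intCast, CharP.intCast_eq_zero_iff k p] at hm
    exact hz hm
  have htf : Module.IsTorsionFree ℤ W := by
    refine .of_smul_eq_zero fun n x hnx ↦ or_iff_not_imp_left.mpr fun hn ↦ ?_
    obtain ⟨m, hnm, hm⟩ := (Int.finiteMultiplicity_iff.mpr
      ⟨by simpa using (Fact.out : p.Prime).ne_one, hn⟩ :
        FiniteMultiplicity (p : ℤ) n).exists_eq_pow_mul_and_not_dvd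
    rw [zsmul_eq_mul, hnm, Int.cast_mul, mul_assoc, Int.cast_pow, Int.cast_natCast,
      mul_left_mem_nonZeroDivisors_eq_zero_iff (pow_mem hp _)] at hnx
    exact (hunit m hm).mul_right_eq_zero.mp hnx
  have hmap (m : ℕ) : (Ideal.span {(p : ℤ) ^ m}).map (algebraMap ℤ W) = Ideal.span {(p : W) ^ m} := by
    simp [Ideal.map_span]
  have hsm : Algebra.FormallySmooth (ℤ ⧸ Ideal.span {(p : ℤ) ^ (n + 1)})
      (W ⧸ (Ideal.span {(p : ℤ) ^ (n + 1)}).map (algebraMap ℤ W)) := by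
    clear hB
    induction n with
    | zero =>
      refine .of_comp_surjective fun B _ _ I hI φ ↦ ?_
      have hk : (Ideal.span {(p : ℤ) ^ (0 + 1)}).map (algebraMap ℤ W) = RingHom.ker r := by
        rw [hmap, hker, zero_add, pow_one]
      let e : (W ⧸ (Ideal.span {(p : ℤ) ^ (0 + 1)}).map (algebraMap ℤ W)) ≃+* k :=
        (Ideal.quotEquivOfEq hk).trans (RingHom.quotientKerEquivOfSurjective hr)
      have hpB : (p : B) = 0 := by
        rw [← map_natCast (algebraMap (ℤ ⧸ Ideal.span {(p : ℤ) ^ (0 + 1)}) B),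
          ← map_natCast (Ideal.Quotient.mk _), Ideal.Quotient.eq_zero_iff_mem.mpr, map_zero]
        simp
      obtain ⟨ψ, hψ⟩ := exists_ringHom_lift_of_sq_eq_bot hpB I hI
        ((φ : _ →+* B ⧸ I).comp e.symm.toRingHom)
      refine ⟨⟨ψ.comp e.toRingHom, fun x ↦ ?_⟩, ?_⟩
      · obtain ⟨x, rfl⟩ := Ideal.Quotient.mk_surjective x
        simp
      · ext x
        simpa using congr($hψ (e x))
    | succ n ih =>
      refine formallySmooth_quotient_of_le ?_ ?_ ih
      · rw [Ideal.span_singleton_le_span_singleton]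
        exact pow_dvd_pow _ (by lia)
      · rw [Ideal.span_singleton_pow, Ideal.span_singleton_le_span_singleton, ← pow_mul]
        exact pow_dvd_pow _ (by lia)
  have hpI : (Ideal.span {(p : ℤ) ^ (n + 1)}) ≤ RingHom.ker (algebraMap ℤ B) := by
    simp [Ideal.span_le, hB]
  let : Algebra (ℤ ⧸ Ideal.span {(p : ℤ) ^ (n + 1)}) B :=
    (Ideal.Quotient.lift _ (algebraMap ℤ B) hpI).toAlgebra
  have hφ : (Ideal.span {(p : ℤ) ^ (n + 1)}).map (algebraMap ℤ W) ≤ RingHom.ker φ := by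
    rw [hmap, Ideal.span_singleton_le_iff_mem, RingHom.mem_ker, map_pow, map_natCast,
      ← map_natCast (Ideal.Quotient.mk I), ← map_pow, hB, map_zero]
  let φ' : (W ⧸ (Ideal.span {(p : ℤ) ^ (n + 1)}).map (algebraMap ℤ W))
      →ₐ[ℤ ⧸ Ideal.span {(p : ℤ) ^ (n + 1)}] B ⧸ I :=
    ⟨Ideal.Quotient.lift _ φ hφ, fun x ↦ by
      obtain ⟨x, rfl⟩ := Ideal.Quotient.mk_surjective x
      simp⟩
  obtain ⟨ψ, hψ⟩ := Algebra.FormallySmooth.comp_surjective _ _ I hI φ'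
  refine ⟨ψ.toRingHom.comp (Ideal.Quotient.mk _), ?_⟩
  ext x
  exact congr($hψ (Ideal.Quotient.mk _ x))

/-! ### Coefficient rings -/

/-- A compatible system of lifts along the surjections `T ⧸ I ^ (n + 2) → T ⧸ I ^ (n + 1)`
defines a homomorphism to an adically complete ring. -/
lemma exists_ringHom_of_lift {W T : Type*} [CommRing W] [CommRing T] (I : Ideal T)
    [IsAdicComplete I T] (g₀ : W →+* T ⧸ I ^ 1)
    (hlift : ∀ (n : ℕ) (φ : W →+* T ⧸ I ^ (n + 1)), ∃ ψ : W →+* T ⧸ I ^ (n + 2),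
      (Ideal.Quotient.factorPow I (n + 1).le_succ).comp ψ = φ) :
    ∃ g : W →+* T, (Ideal.Quotient.mk (I ^ 1)).comp g = g₀ := by
  let g (n : ℕ) : W →+* T ⧸ I ^ (n + 1) := Nat.rec g₀ (fun n φ ↦ (hlift n φ).choose) n
  have hg (n : ℕ) : (Ideal.Quotient.factorPow I (n + 1).le_succ).comp (g (n + 1)) = g n :=
    (hlift n (g n)).choose_spec
  let f (n : ℕ) : W →+* T ⧸ I ^ n := (Ideal.Quotient.factorPow I n.le_succ).comp (g n)
  have hf (n : ℕ) : (Ideal.Quotient.factorPow I n.le_succ).comp (f (n + 1)) = f n := by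
    simp only [f, hg]
  have hf' {m n : ℕ} (hle : m ≤ n) : (Ideal.Quotient.factorPow I hle).comp (f n) = f m := by
    induction n, hle using Nat.le_induction with
    | base => ext x; simp
    | succ n hmn ih =>
      have h : (Ideal.Quotient.factorPow I hmn).comp (Ideal.Quotient.factorPow I n.le_succ) =
          Ideal.Quotient.factorPow I (hmn.trans n.le_succ) :=
        Ideal.Quotient.factor_comp _ _
      rw [← ih, ← h, RingHom.comp_assoc, hf n]
  refine ⟨IsAdicComplete.liftRingHom I f hf', ?_⟩
  ext x
  rw [RingHom.comp_apply, IsAdicComplete.mk_liftRingHom]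
  exact congr($(hg 0) x)

lemma exists_coefficientRing (T : Type) [CommRing T] [IsLocalRing T]
    [IsAdicComplete (maximalIdeal T) T] :
    ∃ (W : Type) (_ : CommRing W) (_ : IsLocalRing W) (_ : IsNoetherianRing W) (ϖ : W)
      (g : W →+* T), maximalIdeal W = Ideal.span {ϖ} ∧ ϖ ∈ nonZeroDivisors W ∧
        ∀ t, ∃ w, t - g w ∈ maximalIdeal T := by
  obtain ⟨p, hp⟩ := CharP.exists (ResidueField T)
  rcases CharP.char_is_prime_or_zero (ResidueField T) p with hprime | rfl
  · have : Fact p.Prime := ⟨hprime⟩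
    obtain ⟨W, _, _, hW, r, hpW, hr, hker⟩ := exists_cohenRing p (ResidueField T)
    have hpT : (p : T) ∈ maximalIdeal T := by
      rw [← residue_eq_zero_iff, map_natCast, CharP.cast_eq_zero]
    have hM : maximalIdeal T = maximalIdeal T ^ 1 := (pow_one _).symm
    let g₀ : W →+* T ⧸ maximalIdeal T ^ 1 := (Ideal.quotEquivOfEq hM).toRingHom.comp r
    obtain ⟨g, hg⟩ := exists_ringHom_of_lift (maximalIdeal T) g₀ fun n φ ↦ by
      have hsurj : Function.Surjective
          (Ideal.Quotient.factorPow (maximalIdeal T) (n + 1).le_succ) :=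
        Ideal.Quotient.factor_surjective _
      let e := RingHom.quotientKerEquivOfSurjective hsurj
      obtain ⟨ψ, hψ⟩ := exists_ringHom_lift_of_ker_eq_span hpW r hr hker (n + 1)
        (B := T ⧸ maximalIdeal T ^ (n + 2)) (by
          rw [← map_natCast (Ideal.Quotient.mk _), ← map_pow, Ideal.Quotient.eq_zero_iff_mem]
          exact Ideal.pow_mem_pow hpT _)
        (RingHom.ker (Ideal.Quotient.factorPow (maximalIdeal T) (n + 1).le_succ)) (by
          rw [Ideal.Quotient.factorPow, Ideal.Quotient.factor_ker, ← Ideal.map_pow,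
            Ideal.map_eq_bot_iff_le_ker, Ideal.mk_ker, ← pow_mul]
          exact Ideal.pow_le_pow_right (by lia)) (e.symm.toRingHom.comp φ)
      refine ⟨ψ, ?_⟩
      ext x
      have := congr(e ($hψ x))
      simpa [e] using! this
    refine ⟨W, _, ‹_›, hW, p, g, ?_, hpW, fun t ↦ ?_⟩
    · rw [← hker, eq_maximalIdeal (RingHom.ker_isMaximal_of_surjective r hr)]
    · obtain ⟨w, hw⟩ := hr (residue T t)
      refine ⟨w, ?_⟩
      have h1 : Ideal.Quotient.mk (maximalIdeal T ^ 1) (g w) =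
          Ideal.Quotient.mk (maximalIdeal T ^ 1) t := by
        have h2 : Ideal.Quotient.mk (maximalIdeal T ^ 1) (g w) =
            Ideal.quotEquivOfEq hM (r w) := congr($hg w)
        rw [h2, hw]
        rfl
      rw [eq_comm, Ideal.Quotient.eq, pow_one] at h1
      exact h1
  · have : CharZero (ResidueField T) := CharP.charP_to_charZero _
    obtain ⟨_⟩ : Nonempty (Algebra ℚ T) := by
      rw [EqualCharZero.nonempty_algebraRat_iff]
      intro I hI
      have : CharZero (T ⧸ maximalIdeal T) := this
      exact RingHom.charZero (Ideal.Quotient.factor (le_maximalIdeal hI) :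
        T ⧸ I →+* T ⧸ maximalIdeal T)
    let k := ResidueField T
    obtain ⟨s, hs⟩ := exists_isTranscendenceBasis ℚ k
    have hsm : Algebra.FormallySmooth ℚ k := by
      have := hs.isAlgebraic_field
      exact .of_algebraicIndependent_of_isSeparable hs.1
    obtain ⟨g, hg⟩ := Algebra.FormallySmooth.exists_mkₐ_comp_eq_of_isAdicComplete
      (I := maximalIdeal T) (RingHom.toRatAlgHom (RingHom.id k : k →+* T ⧸ maximalIdeal T))
    refine ⟨PowerSeries k, inferInstance, inferInstance, inferInstance, PowerSeries.X,
      g.toRingHom.comp PowerSeries.constantCoeff, PowerSeries.maximalIdeal_eq_span_X,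
      mem_nonZeroDivisors_of_ne_zero PowerSeries.X_ne_zero, fun t ↦ ?_⟩
    refine ⟨PowerSeries.C (residue T t), ?_⟩
    have := congr($hg (residue T t))
    rw [← residue_eq_zero_iff, map_sub, sub_eq_zero]
    simpa using! this.symm

/-- Along a covering relation in the spectrum of a complete Noetherian local ring, the coheight
changes by one. -/
lemma coheight_eq_of_covBy {T : Type} [CommRing T] [IsLocalRing T] [IsNoetherianRing T]
    [IsAdicComplete (maximalIdeal T) T] {p q : PrimeSpectrum T} (hpq : p ⋖ q) :
    Order.coheight p = Order.coheight q + 1 := by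
  obtain ⟨W, _, _, _, ϖ, g, hϖ, hreg, hg⟩ := exists_coefficientRing T
  exact coheight_eq_of_coefficientRing hϖ hreg g hg hpq

/-! ### Large families with regular differences -/

/-- Choose sums of the power series with coefficients `0` and `1`, evaluated at an element of the
ideal of an adically complete ring. -/
lemma exists_binary_expansion {T : Type*} [CommRing T] {I : Ideal T} [IsAdicComplete I T]
    {a : T} (ha : a ∈ I) :
    ∃ σ : (ℕ → Bool) → T, ∀ ε, σ ε = (if ε 0 then 1 else 0) + a * σ fun n ↦ ε (n + 1) := by
  let S (ε : ℕ → Bool) (N : ℕ) : T := ∑ n ∈ Finset.range N, (if ε n then 1 else 0) * a ^ n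
  have hS (ε : ℕ → Bool) {m n : ℕ} (hmn : m ≤ n) : S ε m ≡ S ε n [SMOD (I ^ m • ⊤ : Ideal T)] := by
    rw [SModEq.comm, SModEq.sub_mem, smul_eq_mul, Ideal.mul_top, ← Finset.sum_sdiff_eq_sub
      (Finset.range_subset_range.2 hmn)]
    refine Ideal.sum_mem _ fun i hi ↦ Ideal.mul_mem_left _ _ ?_
    simp only [Finset.mem_sdiff, Finset.mem_range, not_lt] at hi
    exact Ideal.pow_le_pow_right hi.2 (Ideal.pow_mem_pow ha _)
  choose σ hσ using fun ε ↦ IsPrecomplete.prec (I := I) inferInstance (hS ε)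
  refine ⟨σ, fun ε ↦ ?_⟩
  rw [← sub_eq_zero]
  refine IsHausdorff.haus (I := I) inferInstance _ fun N ↦ ?_
  have h1 := hσ ε (N + 1)
  have h2 := hσ (fun n ↦ ε (n + 1)) N
  rw [SModEq.sub_mem, smul_eq_mul, Ideal.mul_top] at h1 h2 ⊢
  have h3 : S ε (N + 1) = (if ε 0 then 1 else 0) + a * S (fun n ↦ ε (n + 1)) N := by
    simp only [S, Finset.sum_range_succ' _ N, Finset.mul_sum]
    rw [add_comm, pow_zero, mul_one]
    congr 1
    exact Finset.sum_congr rfl fun _ _ ↦ by ring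
  have h4 := Ideal.sub_mem _ (Ideal.mul_mem_left _ a h2) (Ideal.pow_le_pow_right N.le_succ h1)
  rw [h3] at h4
  convert h4 using 1
  ring

lemma exists_binary_family {T : Type*} [CommRing T] [IsLocalRing T]
    [IsAdicComplete (maximalIdeal T) T] {a : T} (ha : a ∈ maximalIdeal T)
    (ha' : a ∈ nonZeroDivisors T) :
    ∃ σ : (ℕ → Bool) → T, ∀ ε ε', ε ≠ ε' → σ ε - σ ε' ∈ nonZeroDivisors T := by
  obtain ⟨σ, hσ⟩ := exists_binary_expansion ha
  have key (N : ℕ) : ∀ ε ε' : ℕ → Bool, (∀ i < N, ε i = ε' i) → ε N ≠ ε' N →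
      σ ε - σ ε' ∈ nonZeroDivisors T := by
    induction N with
    | zero =>
      intro ε ε' _ h
      have haM (t : T) : IsUnit (1 - a * t) := by
        by_contra hu
        have := (maximalIdeal T).add_mem hu (Ideal.mul_mem_right t _ ha)
        rw [sub_add_cancel] at this
        exact one_notMem_nonunits this
      apply IsUnit.mem_nonZeroDivisors
      rw [hσ ε, hσ ε']
      generalize (σ fun n ↦ ε (n + 1)) = x, (σ fun n ↦ ε' (n + 1)) = y
      rcases Bool.eq_false_or_eq_true (ε 0) with h0 | h0 <;>
        rcases Bool.eq_false_or_eq_true (ε' 0) with h0' | h0' <;>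
        simp only [h0, h0', ne_eq, not_true_eq_false] at h
      · rw [show (if ε 0 then 1 else 0) + a * x - ((if ε' 0 then 1 else 0) + a * y) =
          1 - a * (y - x) by simp [h0, h0']; ring]
        exact haM _
      · rw [show (if ε 0 then 1 else 0) + a * x - ((if ε' 0 then 1 else 0) + a * y) =
          -(1 - a * (x - y)) by simp [h0, h0']; ring]
        exact (haM _).neg
    | succ N ih =>
      intro ε ε' h h'
      have := ih (fun n ↦ ε (n + 1)) (fun n ↦ ε' (n + 1)) (fun i hi ↦ h _ (by lia)) h'
      rw [hσ ε, hσ ε', h 0 (by lia), add_sub_add_left_eq_sub, ← mul_sub]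
      exact mul_mem ha' this
  refine ⟨σ, fun ε ε' h ↦ ?_⟩
  have hne := Function.ne_iff.1 h
  exact key (Nat.find hne) ε ε' (fun i hi ↦ not_not.1 (Nat.find_min hne hi)) (Nat.find_spec hne)

open Cardinal in
/-- A complete local ring whose maximal ideal contains a regular element has a large family
of elements with regular differences. -/
lemma exists_regular_family (T : Type) [CommRing T] [IsLocalRing T]
    [IsAdicComplete (maximalIdeal T) T] {a : T} (ha : a ∈ maximalIdeal T)
    (ha' : a ∈ nonZeroDivisors T) :
    ∃ F : Set T, (∀ s ∈ F, ∀ t ∈ F, s ≠ t → s - t ∈ nonZeroDivisors T) ∧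
      max #(ResidueField T) ℵ₁ ≤ #F := by
  rcases le_total ℵ₁ #(ResidueField T) with h | h
  · have hs := residue_surjective (R := T)
    refine ⟨Set.range (Function.surjInv hs), ?_, ?_⟩
    · rintro _ ⟨x, rfl⟩ _ ⟨y, rfl⟩ hxy
      apply IsUnit.mem_nonZeroDivisors
      rw [← residue_ne_zero_iff_isUnit, map_sub, Function.surjInv_eq hs, Function.surjInv_eq hs,
        sub_ne_zero]
      exact fun h ↦ hxy (by rw [h])
    · rw [mk_range_eq _ (Function.injective_surjInv hs), max_eq_left h]
  · obtain ⟨σ, hσ⟩ := exists_binary_family ha ha'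
    have hinj : Function.Injective σ := by
      intro ε ε' h
      by_contra hne
      have := hσ ε ε' hne
      rw [h, sub_self] at this
      have := zero_notMem_nonZeroDivisors this
      exact this
    refine ⟨Set.range σ, ?_, ?_⟩
    · rintro _ ⟨x, rfl⟩ _ ⟨y, rfl⟩ hxy
      exact hσ x y fun h ↦ hxy (by rw [h])
    · rw [max_eq_right h, mk_range_eq _ hinj]
      simpa using aleph_one_le_continuum

/-! ### Subrings without zero divisors of the ambient ring -/

/-- A subring all of whose nonzero elements are regular in the ambient ring. -/
def IsRegularSubring {T : Type*} [CommRing T] (R : Subring T) : Prop :=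
  ∀ a ∈ R, a ≠ 0 → a ∈ nonZeroDivisors T

/-- The element `c` is a linear combination of the elements of `s` with coefficients in `R`. -/
def HasCombination {T : Type*} [CommRing T] (R : Subring T) (c : T) (s : Finset T) : Prop :=
  ∃ r : T → T, (∀ b, r b ∈ R) ∧ c = ∑ b ∈ s, r b * b

lemma HasCombination.mono {T : Type*} [CommRing T] {R R' : Subring T} (h : R ≤ R') {c : T}
    {s : Finset T} : HasCombination R c s → HasCombination R' c s :=
  fun ⟨r, hr, hc⟩ ↦ ⟨r, fun b ↦ h (hr b), hc⟩

lemma HasCombination.zero {T : Type*} [CommRing T] (R : Subring T) (s : Finset T) :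
    HasCombination R 0 s :=
  ⟨fun _ ↦ 0, fun _ ↦ R.zero_mem, by simp⟩

lemma HasCombination.insert {T : Type*} [CommRing T] [DecidableEq T] {R : Subring T} {c u b : T}
    {s : Finset T} (hb : b ∉ s) (hu : u ∈ R) (h : HasCombination R (c - u * b) s) :
    HasCombination R c (insert b s) := by
  obtain ⟨r, hr, hc⟩ := h
  refine ⟨Function.update r b u, fun x ↦ ?_, ?_⟩
  · rcases eq_or_ne x b with rfl | hx
    · simpa using hu
    · simpa [hx] using hr x
  · rw [Finset.sum_insert hb, Function.update_self, eq_comm, ← eq_sub_iff_add_eq', hc]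
    refine Finset.sum_congr rfl fun x hx ↦ ?_
    rw [Function.update_of_ne (by rintro rfl; exact hb hx)]

/-- The subring generated by a subring and an element. -/
noncomputable def Subring.adjoinElement {T : Type*} [CommRing T] (R : Subring T) (u : T) :
    Subring T :=
  (Polynomial.aeval (R := R) u).range.toSubring

lemma Subring.le_adjoinElement {T : Type*} [CommRing T] (R : Subring T) (u : T) :
    R ≤ R.adjoinElement u :=
  fun x hx ↦ ⟨Polynomial.C ⟨x, hx⟩, by simp; rfl⟩

lemma Subring.mem_adjoinElement_self {T : Type*} [CommRing T] (R : Subring T) (u : T) :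
    u ∈ R.adjoinElement u :=
  ⟨Polynomial.X, by simp⟩

open Cardinal in
lemma Subring.mk_adjoinElement_le {T : Type*} [CommRing T] (R : Subring T) (u : T) :
    #(R.adjoinElement u) ≤ max #R ℵ₀ := by
  refine le_trans ?_ (Polynomial.cardinalMk_le_max (R := R))
  exact mk_le_of_surjective (f := (Polynomial.aeval (R := R) u).rangeRestrict)
    (AlgHom.rangeRestrict_surjective _)

/-- A subring stays regular after adjoining a fraction. -/
lemma IsRegularSubring.adjoinElement_of_mul_mem {T : Type*} [CommRing T] {R : Subring T}
    (hR : IsRegularSubring R) {a t : T} (ha : a ∈ R) (ha0 : a ≠ 0) (hat : a * t ∈ R) :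
    IsRegularSubring (R.adjoinElement t) := by
  rintro _ ⟨f, rfl⟩ hf
  have hareg := hR a ha ha0
  have key : ∃ N : ℕ, a ^ N * Polynomial.aeval t f ∈ R := by
    induction f using Polynomial.induction_on' with
    | add p q hp hq =>
      rcases eq_or_ne (Polynomial.aeval t p) 0 with h0 | h0
      · rw [map_add, h0, zero_add]
        refine hq ?_
        rintro h
        exact hf (by simpa [h0] using h)
      rcases eq_or_ne (Polynomial.aeval t q) 0 with h1 | h1
      · rw [map_add, h1, add_zero]
        exact hp h0
      obtain ⟨N, hN⟩ := hp h0
      obtain ⟨K, hK⟩ := hq h1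
      refine ⟨N + K, ?_⟩
      rw [map_add, show a ^ (N + K) * (Polynomial.aeval t p + Polynomial.aeval t q) =
        a ^ K * (a ^ N * Polynomial.aeval t p) + a ^ N * (a ^ K * Polynomial.aeval t q) by ring]
      exact R.add_mem (R.mul_mem (R.pow_mem ha _) hN) (R.mul_mem (R.pow_mem ha _) hK)
    | monomial n r =>
      refine ⟨n, ?_⟩
      rw [Polynomial.aeval_monomial, mul_left_comm, ← mul_pow]
      exact R.mul_mem r.2 (R.pow_mem hat _)
  obtain ⟨N, hN⟩ := key
  have h1 : a ^ N ∈ nonZeroDivisors T := pow_mem hareg N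
  have h2 : a ^ N * Polynomial.aeval t f ≠ 0 := fun h ↦
    hf ((mul_left_mem_nonZeroDivisors_eq_zero_iff h1).1 h)
  exact (mul_mem_nonZeroDivisors.1 (hR _ hN h2)).2

open Cardinal in
/-- In a coset of a regular principal ideal there is an element that can be adjoined to a small
regular subring. -/
lemma IsRegularSubring.exists_adjoinElement {T : Type} [CommRing T] [IsNoetherianRing T]
    {R : Subring T} (hR : IsRegularSubring R) {F : Set T}
    (hF : ∀ s ∈ F, ∀ t ∈ F, s ≠ t → s - t ∈ nonZeroDivisors T)
    (hRF : #R < #F) (hF' : ℵ₀ < #F) (t : T) {a : T} (ha : a ∈ nonZeroDivisors T) :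
    ∃ s, IsRegularSubring (R.adjoinElement (t + a * s)) := by
  classical
  let bad (f : Polynomial R) (Q : Ideal T) : Set T :=
    {s ∈ F | Polynomial.aeval (t + a * s) f ∈ Q}
  have hzd (x : T) : x ∉ nonZeroDivisors T ↔ ∃ Q ∈ associatedPrimes T T, x ∈ Q := by
    have := Set.ext_iff.1 (biUnion_associatedPrimes_eq_compl_nonZeroDivisors T) x
    simp only [Set.mem_iUnion, SetLike.mem_coe, exists_prop, Set.mem_compl_iff] at this
    exact this.symm
  have hfin (f : Polynomial R) (hf : f ≠ 0) (Q : Ideal T) (hQ : Q ∈ associatedPrimes T T) :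
      (bad f Q).Finite := by
    have : Q.IsPrime := hQ.isPrime
    let φ : R →+* T ⧸ Q := (Ideal.Quotient.mk Q).comp R.subtype
    have hφ : f.map φ ≠ 0 := by
      obtain ⟨n, hn⟩ : ∃ n, f.coeff n ≠ 0 := by
        by_contra! h
        exact hf (Polynomial.ext (by simpa using h))
      intro h
      have h1 : φ (f.coeff n) = 0 := by rw [← Polynomial.coeff_map, h, Polynomial.coeff_zero]
      have h2 : ((f.coeff n : R) : T) ∈ Q := Ideal.Quotient.eq_zero_iff_mem.1 h1
      exact (hzd _).2 ⟨Q, hQ, h2⟩ (hR _ (f.coeff n).2 (by simpa using hn))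
    have hinj : Set.InjOn (fun s ↦ Ideal.Quotient.mk Q (t + a * s)) (bad f Q) := by
      intro s hs s' hs' h
      by_contra hne
      have h1 : a * (s - s') ∈ Q := by
        rw [← Ideal.Quotient.eq_zero_iff_mem]
        simp only [map_add, map_mul, add_right_inj] at h
        rw [map_mul, map_sub, mul_sub, h, sub_self]
      exact (hzd _).2 ⟨Q, hQ, h1⟩ (mul_mem ha (hF s hs.1 s' hs'.1 hne))
    refine Set.Finite.of_finite_image (Set.Finite.subset (f.map φ).roots.toFinset.finite_toSet ?_)
      hinj
    rintro _ ⟨s, hs, rfl⟩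
    simp only [Finset.mem_coe, Multiset.mem_toFinset]
    rw [Polynomial.mem_roots hφ, Polynomial.IsRoot, Polynomial.eval_map]
    have := Ideal.Quotient.eq_zero_iff_mem.2 hs.2
    rwa [Polynomial.aeval_def, Polynomial.hom_eval₂] at this
  let B : Set T := ⋃ x : {f : Polynomial R // f ≠ 0} × associatedPrimes T T, bad x.1 x.2
  have hB : #B < #F := by
    refine lt_of_le_of_lt ((mk_iUnion_le _).trans (mul_le_max _ _)) ?_
    refine max_lt (max_lt ?_ ?_) hF'
    · have : Finite (associatedPrimes T T) := associatedPrimes.finite T T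
      rw [mk_prod, lift_id, lift_id]
      refine lt_of_le_of_lt (mul_le_max _ _) (max_lt (max_lt ?_ ?_) hF')
      · refine lt_of_le_of_lt (mk_subtype_le _) ?_
        exact lt_of_le_of_lt Polynomial.cardinalMk_le_max (max_lt hRF hF')
      · exact (lt_aleph0_of_finite _).trans hF'
    · refine lt_of_le_of_lt (ciSup_le' fun x ↦ ?_) hF'
      exact ((hfin x.1 x.1.2 x.2 x.2.2).lt_aleph0).le
  obtain ⟨s, hsF, hsB⟩ : ∃ s ∈ F, s ∉ B := by
    by_contra! h
    exact absurd (mk_le_mk_of_subset h) (not_le.2 hB)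
  refine ⟨s, ?_⟩
  rintro _ ⟨f, rfl⟩ hf
  by_contra hz
  obtain ⟨Q, hQ, hmem⟩ := (hzd _).1 hz
  exact hsB (Set.mem_iUnion.2 ⟨⟨⟨f, fun h ↦ hf (by simp [h])⟩, ⟨Q, hQ⟩⟩, hsF, hmem⟩)

open Cardinal in
/-- A relation over the ambient ring between elements of a small regular subring becomes a
relation over a larger regular subring. -/
lemma IsRegularSubring.exists_hasCombination {T : Type} [CommRing T] [IsNoetherianRing T]
    {F : Set T} (hF : ∀ s ∈ F, ∀ t ∈ F, s ≠ t → s - t ∈ nonZeroDivisors T) (hF' : ℵ₀ < #F)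
    (s : Finset T) : ∀ {R : Subring T} (_ : IsRegularSubring R) (_ : #R < #F) {c : T} (_ : c ∈ R)
      (_ : ∀ b ∈ s, b ∈ R) (_ : c ∈ Ideal.span (s : Set T)),
    ∃ R' ≥ R, IsRegularSubring R' ∧ #R' ≤ max #R ℵ₀ ∧ HasCombination R' c s := by
  classical
  induction s using Finset.induction_on with
  | empty =>
    intro R hR _ c _ _ hcs
    have : c = 0 := by simpa using hcs
    subst this
    exact ⟨R, le_rfl, hR, le_max_left _ _, .zero _ _⟩
  | insert b s hb ih =>
    intro R hR hRF c hc hs hcs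
    rw [Finset.coe_insert, Ideal.mem_span_insert] at hcs
    obtain ⟨t, z, hz, rfl⟩ := hcs
    have hbR : b ∈ R := hs b (Finset.mem_insert_self _ _)
    have hsR : ∀ b ∈ s, b ∈ R := fun b hb ↦ hs b (Finset.mem_insert_of_mem hb)
    by_cases h : ∃ b' ∈ s, b' ≠ 0
    · obtain ⟨b', hb', hb'0⟩ := h
      obtain ⟨σ, hσ⟩ := hR.exists_adjoinElement hF hRF hF' t (hR b' (hsR b' hb') hb'0)
      set u := t + b' * σ with hu
      have hle := R.le_adjoinElement u
      have hcard := R.mk_adjoinElement_le u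
      have hmem := R.mem_adjoinElement_self u
      obtain ⟨R', hR', hreg, hcard', hcomb⟩ := ih hσ (hcard.trans_lt (max_lt hRF hF'))
        (c := t * b + z - u * b)
        (Subring.sub_mem _ (hle hc) (Subring.mul_mem _ hmem (hle hbR)))
        (fun b hb ↦ hle (hsR b hb)) (by
          rw [hu, show t * b + z - (t + b' * σ) * b = z - (σ * b) * b' by ring]
          exact Ideal.sub_mem _ hz (Ideal.mul_mem_left _ _ (Ideal.subset_span hb')))
      refine ⟨R', hle.trans hR', hreg, hcard'.trans (max_le hcard (le_max_right _ _)), ?_⟩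
      exact hcomb.insert hb (hR' hmem)
    · push Not at h
      have hz0 : z = 0 := by
        have : Ideal.span (s : Set T) = ⊥ := Ideal.span_eq_bot.2 h
        simpa [this] using hz
      subst hz0
      rw [add_zero] at hc ⊢
      rcases eq_or_ne b 0 with rfl | hb0
      · rw [mul_zero]
        exact ⟨R, le_rfl, hR, le_max_left _ _, .zero _ _⟩
      · refine ⟨R.adjoinElement t, R.le_adjoinElement t,
          hR.adjoinElement_of_mul_mem hbR hb0 (by rwa [mul_comm]), R.mk_adjoinElement_le t, ?_⟩
        refine HasCombination.insert hb (R.mem_adjoinElement_self t) ?_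
        rw [sub_self]
        exact .zero _ _

/-! ### Transfinite constructions of subrings -/

open Cardinal in
lemma mk_sSup_insert_le {T : Type} [CommRing T] {R : Subring T} {ι : Type} {G : ι → Subring T}
    (hdir : DirectedOn (· ≤ ·) (insert R (Set.range G))) {c : Cardinal} (hc : ℵ₀ ≤ c)
    (hR : #R ≤ c) (hι : #ι ≤ c) (hG : ∀ i, #(G i) ≤ c) :
    #(sSup (insert R (Set.range G)) : Subring T) ≤ c := by
  have h : ((sSup (insert R (Set.range G)) : Subring T) : Set T) =
      (R : Set T) ∪ ⋃ i, (G i : Set T) := by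
    rw [Subring.coe_sSup_of_directedOn (Set.insert_nonempty _ _) hdir]
    simp
  rw [← SetLike.coe_sort_coe, h]
  refine (mk_union_le _ _).trans (add_le_of_le hc hR ?_)
  exact (mk_iUnion_le _).trans (mul_le_of_le hc hι (ciSup_le' hG))

open Cardinal in
/-- Starting from a small subring, a family of tasks can be carried out one after another, without
enlarging the subring too much. -/
lemma exists_subring_of_tasks {T : Type} [CommRing T] {P : Subring T → Prop}
    (hP : ∀ S : Set (Subring T), S.Nonempty → DirectedOn (· ≤ ·) S → (∀ R ∈ S, P R) → P (sSup S))
    {c : Cardinal} (hc : ℵ₀ < c) {ι : Type} (hι : #ι ≤ c) (τ : ι → Subring T → Prop)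
    (hτ : ∀ i R R', R ≤ R' → τ i R → τ i R')
    (step : ∀ i R, P R → #R < c → ∃ R' ≥ R, P R' ∧ #R' ≤ max #R ℵ₀ ∧ τ i R')
    {R : Subring T} (hR : P R) (hRc : #R < c) :
    ∃ R' ≥ R, P R' ∧ #R' ≤ max (max #R ℵ₀) #ι ∧ ∀ i, τ i R' := by
  classical
  let J := (#ι).ord.ToType
  have hJ : #J = #ι := mk_ord_toType _
  obtain ⟨e⟩ := Cardinal.eq.1 hJ
  have hIio (i : J) : #(Set.Iio i) < c :=
    (mk_Iio_lt i (by rw [hJ, Ordinal.type_toType])).trans_le (hJ.trans_le hι)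
  let st (i : J) (L : Subring T) : Subring T :=
    if h : P L ∧ #L < c then (step (e i) L h.1 h.2).choose else L
  have hst_le (i : J) (L : Subring T) : L ≤ st i L := by
    by_cases h : P L ∧ #L < c
    · simp only [st, dif_pos h]
      exact (step (e i) L h.1 h.2).choose_spec.1
    · simp only [st, dif_neg h, le_refl]
  have hst (i : J) (L : Subring T) (h1 : P L) (h2 : #L < c) :
      P (st i L) ∧ #(st i L) ≤ max #L ℵ₀ ∧ τ (e i) (st i L) := by
    have h : P L ∧ #L < c := ⟨h1, h2⟩
    simp only [st, dif_pos h]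
    exact (step (e i) L h.1 h.2).choose_spec.2
  let G : J → Subring T := WellFoundedLT.fix fun i g ↦
    st i (sSup (insert R (Set.range fun j : Set.Iio i ↦ g j.1 j.2)))
  let L (i : J) : Subring T := sSup (insert R (Set.range fun j : Set.Iio i ↦ G j))
  have hG (i : J) : G i = st i (L i) := WellFoundedLT.fix_eq _ i
  have hRG (i : J) : R ≤ G i := by
    rw [hG]
    exact (le_sSup (Set.mem_insert _ _)).trans (hst_le _ _)
  have hmono : Monotone G := by
    intro j i hji
    rcases hji.eq_or_lt with rfl | hlt
    · rfl
    · rw [hG i]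
      have : G j ∈ insert R (Set.range fun j : Set.Iio i ↦ G j) :=
        Set.mem_insert_of_mem _ ⟨⟨j, hlt⟩, rfl⟩
      exact (le_sSup this).trans (hst_le _ _)
  have hdir {K : Type} (f : K → J) : DirectedOn (· ≤ ·) (insert R (Set.range fun k ↦ G (f k))) := by
    refine IsChain.directedOn ?_
    refine IsChain.insert ?_ ?_
    · rintro _ ⟨i, rfl⟩ _ ⟨j, rfl⟩ _
      exact (le_total (f i) (f j)).imp (fun h ↦ hmono h) (fun h ↦ hmono h)
    · rintro _ ⟨i, rfl⟩ _
      exact Or.inl (hRG _)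
  have key (i : J) : P (G i) ∧ #(G i) ≤ max (max #R ℵ₀) #(Set.Iio i) ∧ τ (e i) (G i) := by
    induction i using WellFoundedLT.induction with
    | ind i ih =>
      have hLP : P (L i) := by
        refine hP _ (Set.insert_nonempty _ _) (hdir _) ?_
        rintro _ (rfl | ⟨j, rfl⟩)
        · exact hR
        · exact (ih j j.2).1
      have hLc : #(L i) ≤ max (max #R ℵ₀) #(Set.Iio i) := by
        refine mk_sSup_insert_le (hdir _) (by simp) (by simp) (by simp) fun j ↦ ?_
        exact (ih j j.2).2.1.trans
          (max_le_max le_rfl (mk_le_mk_of_subset (Set.Iio_subset_Iio j.2.le)))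
      obtain ⟨h1, h2, h3⟩ := hst i (L i) hLP
        (hLc.trans_lt (max_lt (max_lt hRc hc) (hIio i)))
      rw [hG]
      exact ⟨h1, h2.trans (max_le hLc (by simp)), h3⟩
  refine ⟨sSup (insert R (Set.range G)), le_sSup (Set.mem_insert _ _), ?_, ?_, fun i ↦ ?_⟩
  · refine hP _ (Set.insert_nonempty _ _) (hdir id) ?_
    rintro _ (rfl | ⟨j, rfl⟩)
    · exact hR
    · exact (key j).1
  · refine mk_sSup_insert_le (hdir id) (by simp) (by simp) (by simp [hJ]) fun j ↦ ?_
    refine (key j).2.1.trans (max_le_max le_rfl ?_)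
    exact (mk_set_le _).trans hJ.le
  · rw [← e.apply_symm_apply i]
    exact hτ _ _ _ (le_sSup (Set.mem_insert_of_mem _ ⟨e.symm i, rfl⟩)) (key _).2.2

/-- A subring `R` is relatively closed if every relation over the ambient ring between elements
of `R` comes from a relation over `R`. -/
def IsRelativelyClosed {T : Type*} [CommRing T] (R : Subring T) : Prop :=
  ∀ c ∈ R, ∀ s : Finset T, (∀ b ∈ s, b ∈ R) → c ∈ Ideal.span (s : Set T) → HasCombination R c s

lemma IsRegularSubring.of_directedOn {T : Type*} [CommRing T] {S : Set (Subring T)} (hne : S.Nonempty)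
    (hdir : DirectedOn (· ≤ ·) S) (hS : ∀ R ∈ S, IsRegularSubring R) :
    IsRegularSubring (sSup S) := by
  intro a ha ha0
  obtain ⟨R, hR, haR⟩ := (Subring.mem_sSup_of_directedOn hne hdir).1 ha
  exact hS R hR a haR ha0

lemma exists_mem_of_mem_sSup {T : Type*} [CommRing T] {S : Set (Subring T)} (hne : S.Nonempty)
    (hdir : DirectedOn (· ≤ ·) S) (s : Finset T) (hs : ∀ b ∈ s, b ∈ sSup S) :
    ∃ R ∈ S, ∀ b ∈ s, b ∈ R := by
  classical
  induction s using Finset.induction_on with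
  | empty => exact ⟨hne.some, hne.some_mem, by simp⟩
  | insert b s hb ih =>
    obtain ⟨R, hR, h⟩ := ih fun b hb ↦ hs b (Finset.mem_insert_of_mem hb)
    obtain ⟨R', hR', h'⟩ := (Subring.mem_sSup_of_directedOn hne hdir).1
      (hs b (Finset.mem_insert_self _ _))
    obtain ⟨R'', hR'', h1, h2⟩ := hdir R hR R' hR'
    refine ⟨R'', hR'', fun x hx ↦ ?_⟩
    rcases Finset.mem_insert.1 hx with rfl | hx
    · exact h2 h'
    · exact h1 (h x hx)

lemma IsRelativelyClosed.of_directedOn {T : Type*} [CommRing T] {S : Set (Subring T)} (hne : S.Nonempty)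
    (hdir : DirectedOn (· ≤ ·) S) (hS : ∀ R ∈ S, IsRelativelyClosed R) :
    IsRelativelyClosed (sSup S) := by
  classical
  intro c hc s hs hcs
  obtain ⟨R, hR, h⟩ := exists_mem_of_mem_sSup hne hdir (insert c s) fun b hb ↦ by
    rcases Finset.mem_insert.1 hb with rfl | hb
    · exact hc
    · exact hs b hb
  exact (hS R hR c (h c (Finset.mem_insert_self _ _)) s
    (fun b hb ↦ h b (Finset.mem_insert_of_mem hb)) hcs).mono (le_sSup hR)

open Cardinal in
/-- A small regular subring is contained in a small relatively closed regular subring. -/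
lemma IsRegularSubring.exists_isRelativelyClosed {T : Type} [CommRing T] [IsNoetherianRing T]
    {F : Set T} (hF : ∀ s ∈ F, ∀ t ∈ F, s ≠ t → s - t ∈ nonZeroDivisors T) (hF' : ℵ₀ < #F)
    {R : Subring T} (hR : IsRegularSubring R) (hRF : #R < #F) :
    ∃ R' ≥ R, IsRegularSubring R' ∧ IsRelativelyClosed R' ∧ #R' ≤ max #R ℵ₀ := by
  have one (R : Subring T) (hR : IsRegularSubring R) (hRF : #R < #F) :
      ∃ R' ≥ R, IsRegularSubring R' ∧ #R' ≤ max #R ℵ₀ ∧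
        ∀ c ∈ R, ∀ s : Finset T, (∀ b ∈ s, b ∈ R) → c ∈ Ideal.span (s : Set T) →
          HasCombination R' c s := by
    classical
    let emb : Finset R → Finset T := fun s ↦ s.image Subtype.val
    have hι : #(R × Finset R) ≤ max #R ℵ₀ := by
      rw [mk_prod, lift_id, lift_id]
      refine mul_le_of_le (le_max_right _ _) (le_max_left _ _) ?_
      rcases finite_or_infinite R with h | h
      · exact (lt_aleph0_of_finite _).le.trans (le_max_right _ _)
      · rw [mk_finset_of_infinite]
        exact le_max_left _ _
    obtain ⟨R', h1, h2, h3, h4⟩ := exists_subring_of_tasks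
      (P := fun R' ↦ IsRegularSubring R' ∧ R ≤ R')
      (fun S h1 h2 h3 ↦ ⟨.of_directedOn h1 h2 fun R hR ↦ (h3 R hR).1,
        (h3 _ h1.some_mem).2.trans (le_sSup h1.some_mem)⟩)
      hF' (hι.trans (max_le hRF.le hF'.le))
      (fun x R' ↦ (x.1 : T) ∈ Ideal.span (emb x.2 : Set T) → HasCombination R' x.1 (emb x.2))
      (fun i R₁ R₂ h h' h1 ↦ (h' h1).mono h) (fun i R₁ h1 h2 ↦ by
        by_cases h : (i.1 : T) ∈ Ideal.span (emb i.2 : Set T)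
        · obtain ⟨R', h3, h4, h5, h6⟩ := h1.1.exists_hasCombination hF hF' (emb i.2) h2
            (h1.2 i.1.2) (fun b hb ↦ by
              obtain ⟨y, _, rfl⟩ := Finset.mem_image.1 hb
              exact h1.2 y.2) h
          exact ⟨R', h3, ⟨h4, h1.2.trans h3⟩, h5, fun _ ↦ h6⟩
        · exact ⟨R₁, le_rfl, h1, le_max_left _ _, fun h' ↦ absurd h' h⟩)
      ⟨hR, le_rfl⟩ hRF
    refine ⟨R', h1, h2.1, h3.trans (max_le le_rfl hι), fun c hc s hs hcs ↦ ?_⟩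
    let s' : Finset R := s.subtype (· ∈ R)
    have hs' : emb s' = s := by
      ext x
      simp only [emb, s', Finset.mem_image, Finset.mem_subtype]
      exact ⟨by rintro ⟨y, hy, rfl⟩; exact hy, fun hx ↦ ⟨⟨x, hs x hx⟩, hx, rfl⟩⟩
    have := h4 (⟨c, hc⟩, s')
    rw [hs'] at this
    exact this hcs
  choose! next hle hreg hcard hcomb using one
  let G : ℕ → Subring T := fun n ↦ next^[n] R
  have hG (n : ℕ) : IsRegularSubring (G n) ∧ #(G n) ≤ max #R ℵ₀ := by
    induction n with
    | zero => exact ⟨hR, le_max_left _ _⟩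
    | succ n ih =>
      have hlt := ih.2.trans_lt (max_lt hRF hF')
      simp only [G, Function.iterate_succ_apply']
      exact ⟨hreg _ ih.1 hlt, (hcard _ ih.1 hlt).trans (max_le ih.2 (le_max_right _ _))⟩
  have hlt (n : ℕ) : #(G n) < #F := (hG n).2.trans_lt (max_lt hRF hF')
  have hsucc (n : ℕ) : G (n + 1) = next (G n) := Function.iterate_succ_apply' _ _ _
  have hmono : Monotone G := monotone_nat_of_le_succ fun n ↦ by
    rw [hsucc]
    exact hle _ (hG n).1 (hlt n)
  have hins : insert R (Set.range G) = Set.range G := Set.insert_eq_of_mem ⟨0, rfl⟩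
  have hdir : DirectedOn (· ≤ ·) (Set.range G) := directedOn_range.2 hmono.directed_le
  have hne : (Set.range G).Nonempty := Set.range_nonempty _
  refine ⟨sSup (Set.range G), le_sSup ⟨0, rfl⟩, .of_directedOn hne hdir ?_, fun c hc s hs hcs ↦ ?_, ?_⟩
  · rintro _ ⟨n, rfl⟩
    exact (hG n).1
  · classical
    obtain ⟨_, ⟨n, rfl⟩, h⟩ := exists_mem_of_mem_sSup hne hdir (insert c s) fun b hb ↦ by
      rcases Finset.mem_insert.1 hb with rfl | hb
      · exact hc
      · exact hs b hb
    refine (hcomb _ (hG n).1 (hlt n) c (h c (Finset.mem_insert_self _ _)) s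
      (fun b hb ↦ h b (Finset.mem_insert_of_mem hb)) hcs).mono ?_
    rw [← hsucc]
    exact le_sSup ⟨n + 1, rfl⟩
  · rw [← hins] at hdir ⊢
    exact mk_sSup_insert_le hdir (le_max_right _ _) (le_max_left _ _) (by simp)
      fun n ↦ (hG n).2

open Cardinal in
/-- The main construction: a regular relatively closed subring meeting prescribed cosets. -/
lemma exists_regular_subring {T : Type} [CommRing T] [IsLocalRing T] [IsNoetherianRing T]
    [IsAdicComplete (maximalIdeal T) T]
    (hT : ∀ z : ℤ, (z : T) ≠ 0 → (z : T) ∈ nonZeroDivisors T)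
    (hM : ∃ a ∈ maximalIdeal T, a ∈ nonZeroDivisors T) {ι : Type}
    (hι : #ι ≤ max #(ResidueField T) ℵ₁) (z : ι → T) (J : ι → Ideal T)
    (hJ : ∀ i, ∃ a ∈ J i, a ∈ nonZeroDivisors T) :
    ∃ R : Subring T, IsRegularSubring R ∧ IsRelativelyClosed R ∧ ∀ i, ∃ r ∈ R, r - z i ∈ J i := by
  obtain ⟨a, ha, ha'⟩ := hM
  obtain ⟨F, hF, hcF⟩ := exists_regular_family T ha ha'
  have hF' : ℵ₀ < #F := aleph0_lt_aleph_one.trans_le ((le_max_right _ _).trans hcF)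
  have hbot : IsRegularSubring (⊥ : Subring T) := by
    intro x hx hx0
    obtain ⟨n, rfl⟩ := Subring.mem_bot.1 hx
    exact hT n hx0
  have hbotc : #(⊥ : Subring T) ≤ ℵ₀ := by
    have : Function.Surjective (fun n : ℤ ↦ (⟨n, Subring.mem_bot.2 ⟨n, rfl⟩⟩ : (⊥ : Subring T))) := by
      rintro ⟨x, hx⟩
      obtain ⟨n, rfl⟩ := Subring.mem_bot.1 hx
      exact ⟨n, rfl⟩
    exact (mk_le_of_surjective this).trans mk_le_aleph0
  obtain ⟨R₀, -, hR₀, hR₀', hR₀c⟩ :=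
    hbot.exists_isRelativelyClosed hF hF' (hbotc.trans_lt hF')
  rw [max_eq_right hbotc] at hR₀c
  obtain ⟨R, -, h1, -, h2⟩ := exists_subring_of_tasks
    (P := fun R ↦ IsRegularSubring R ∧ IsRelativelyClosed R)
    (fun S h1 h2 h3 ↦ ⟨.of_directedOn h1 h2 fun R hR ↦ (h3 R hR).1, .of_directedOn h1 h2 fun R hR ↦ (h3 R hR).2⟩)
    hF' (hι.trans hcF) (fun i R ↦ ∃ r ∈ R, r - z i ∈ J i)
    (fun i R₁ R₂ h ⟨r, hr, hr'⟩ ↦ ⟨r, h hr, hr'⟩) (fun i R h1 h2 ↦ by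
      obtain ⟨w, hw, hw'⟩ := hJ i
      obtain ⟨s, hs⟩ := h1.1.exists_adjoinElement hF h2 hF' (z i) hw'
      have hc := R.mk_adjoinElement_le (z i + w * s)
      obtain ⟨R', h3, h4, h5, h6⟩ :=
        hs.exists_isRelativelyClosed hF hF' (hc.trans_lt (max_lt h2 hF'))
      refine ⟨R', (R.le_adjoinElement _).trans h3, ⟨h4, h5⟩,
        h6.trans (max_le hc (le_max_right _ _)), _, h3 (R.mem_adjoinElement_self _), ?_⟩
      rw [add_sub_cancel_left]
      exact Ideal.mul_mem_right _ _ hw)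
    ⟨hR₀, hR₀'⟩
    (hR₀c.trans_lt hF')
  exact ⟨R, h1.1, h1.2, h2⟩

/-! ### Regular relatively closed subrings -/

lemma IsRegularSubring.isDomain {T : Type*} [CommRing T] [Nontrivial T] {R : Subring T}
    (hR : IsRegularSubring R) : IsDomain R := by
  have : NoZeroDivisors R := ⟨fun {a b} h ↦ by
    by_contra! hab
    have h1 := hR a a.2 (by simpa using hab.1)
    have h2 : (a : T) * b = 0 := congr_arg Subtype.val h
    exact hab.2 (Subtype.ext ((mul_left_mem_nonZeroDivisors_eq_zero_iff h1).1 h2))⟩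
  exact NoZeroDivisors.to_isDomain R

lemma IsRelativelyClosed.isLocalHom {T : Type*} [CommRing T] {R : Subring T}
    (hR : IsRelativelyClosed R) : IsLocalHom R.subtype := by
  refine ⟨fun u hu ↦ ?_⟩
  obtain ⟨r, hr, h⟩ := hR 1 R.one_mem {(u : T)} (by simp) (by
    have : Ideal.span {(u : T)} = ⊤ := Ideal.span_singleton_eq_top.2 hu
    rw [Finset.coe_singleton, this]
    trivial)
  rw [Finset.sum_singleton] at h
  exact IsUnit.of_mul_eq_one_right (⟨r u, hr _⟩ : R) (Subtype.ext h.symm)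

lemma IsRelativelyClosed.exists_finset {T : Type*} [CommRing T] [IsNoetherianRing T]
    {R : Subring T} (hR : IsRelativelyClosed R) (I : Ideal R) :
    ∃ s : Finset R, (s : Set R) ⊆ I ∧
      ∀ c : R, (c : T) ∈ I.map R.subtype → c ∈ Ideal.span (s : Set R) := by
  classical
  obtain ⟨s, hs, hs'⟩ := (Submodule.fg_span_iff_fg_span_finset_subset
    (R := T) (R.subtype '' (I : Set R))).1 (IsNoetherian.noetherian _)
  obtain ⟨s', hs'I, rfl⟩ := Finset.subset_set_image_iff.1 hs
  refine ⟨s', hs'I, fun c hc ↦ ?_⟩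
  have hc' : (c : T) ∈ Ideal.span ((s'.image R.subtype : Finset T) : Set T) := by
    rwa [Ideal.map, Ideal.span, hs'] at hc
  obtain ⟨r, hr, h⟩ := hR c c.2 _ (fun b hb ↦ by
    obtain ⟨x, _, rfl⟩ := Finset.mem_image.1 hb
    exact x.2) hc'
  rw [Finset.sum_image R.subtype_injective.injOn] at h
  have : c = ∑ b ∈ s', (⟨r b, hr _⟩ : R) * b := Subtype.ext (by simpa using! h)
  rw [this]
  exact Ideal.sum_mem _ fun b hb ↦ Ideal.mul_mem_left _ _ (Ideal.subset_span hb)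

lemma IsRelativelyClosed.isNoetherianRing {T : Type*} [CommRing T] [IsNoetherianRing T]
    {R : Subring T} (hR : IsRelativelyClosed R) : IsNoetherianRing R := by
  refine ⟨fun I ↦ ?_⟩
  obtain ⟨s, hs, h⟩ := hR.exists_finset I
  exact ⟨s, le_antisymm (Ideal.span_le.2 hs) fun c hc ↦ h c (Ideal.mem_map_of_mem _ hc)⟩

lemma IsRelativelyClosed.comap_map {T : Type*} [CommRing T] [IsNoetherianRing T]
    {R : Subring T} (hR : IsRelativelyClosed R) (I : Ideal R) :
    (I.map R.subtype).comap R.subtype = I := by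
  obtain ⟨s, hs, h⟩ := hR.exists_finset I
  exact le_antisymm (fun c hc ↦ Ideal.span_le.2 hs (h c hc)) Ideal.le_comap_map

/-- A complete local ring is the completion of a local subring which generates its maximal ideal,
has the same residue field and is relatively closed. -/
lemma nonempty_adicCompletion_algEquiv {T : Type*} [CommRing T] [IsLocalRing T]
    [IsNoetherianRing T] [IsAdicComplete (maximalIdeal T) T] {R : Subring T} [IsLocalRing R]
    (hR : IsRelativelyClosed R) (hM : (maximalIdeal R).map R.subtype = maximalIdeal T)
    (hres : ∀ t, ∃ r ∈ R, r - t ∈ maximalIdeal T) :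
    Nonempty (AdicCompletion (maximalIdeal R) R ≃ₐ[R] T) := by
  set m := maximalIdeal R
  set M := maximalIdeal T
  have hpow (n : ℕ) : (m ^ n).map R.subtype = M ^ n := by rw [Ideal.map_pow, hM]
  have hcomap (n : ℕ) : (M ^ n).comap R.subtype = m ^ n := by rw [← hpow, hR.comap_map]
  have hstep (n : ℕ) (x : T) (hx : x ∈ M ^ n) : ∃ a ∈ m ^ n, x - a ∈ M ^ (n + 1) := by
    rw [← hpow] at hx
    induction hx using Submodule.span_induction with
    | mem x hx =>
      obtain ⟨a, ha, rfl⟩ := hx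
      exact ⟨a, ha, by simp⟩
    | zero => exact ⟨0, zero_mem _, by simp⟩
    | add x y _ _ hx hy =>
      obtain ⟨a, ha, hxa⟩ := hx
      obtain ⟨b, hb, hyb⟩ := hy
      refine ⟨a + b, add_mem ha hb, ?_⟩
      convert add_mem hxa hyb using 1
      push_cast
      ring
    | smul t x _ hx =>
      obtain ⟨a, ha, hxa⟩ := hx
      obtain ⟨r, hr, hrt⟩ := hres t
      refine ⟨⟨r, hr⟩ * a, Ideal.mul_mem_left _ _ ha, ?_⟩
      have h1 : (a : T) ∈ M ^ n := hpow n ▸ Ideal.mem_map_of_mem R.subtype ha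
      have h2 : (r - t) * a ∈ M ^ (n + 1) := by
        rw [pow_succ']
        exact Ideal.mul_mem_mul hrt h1
      convert sub_mem (Ideal.mul_mem_left _ t hxa) h2 using 1
      simp only [Subring.coe_mul, smul_eq_mul]
      ring
  have hdense (n : ℕ) (t : T) : ∃ a : R, (a : T) - t ∈ M ^ n := by
    induction n with
    | zero => exact ⟨0, by simp⟩
    | succ n ih =>
      obtain ⟨a, ha⟩ := ih
      obtain ⟨b, -, hb⟩ := hstep n _ ha
      refine ⟨a - b, ?_⟩
      convert hb using 1
      push_cast
      ring
  let q (n : ℕ) : R ⧸ m ^ n →+* T ⧸ M ^ n :=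
    Ideal.quotientMap (M ^ n) R.subtype (hcomap n).ge
  have hq (n : ℕ) : Function.Injective (q n) := Ideal.quotientMap_injective' (hcomap n).le
  let f (n : ℕ) : AdicCompletion m R →+* T ⧸ M ^ n :=
    (q n).comp (AdicCompletion.evalₐ m n).toRingHom
  have hf {k n : ℕ} (hkn : k ≤ n) : (Ideal.Quotient.factorPow M hkn).comp (f n) = f k := by
    ext x
    obtain ⟨x, rfl⟩ := AdicCompletion.mk_surjective m R x
    have h : x.1 k ≡ x.1 n [SMOD (m ^ k • ⊤ : Ideal R)] := x.2 hkn
    rw [SModEq.comm, SModEq.sub_mem, smul_eq_mul, Ideal.mul_top] at h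
    simp only [f, q, RingHom.comp_apply, AlgHom.toRingHom_eq_coe, RingHom.coe_coe,
      AdicCompletion.evalₐ_mk, Ideal.quotientMap_mk]
    refine Ideal.Quotient.eq.2 ?_
    rw [← hcomap, Ideal.mem_comap, map_sub] at h
    exact h
  let Φ : AdicCompletion m R →+* T := IsAdicComplete.liftRingHom M f hf
  have hΦ (n : ℕ) (x : AdicCompletion m R) :
      Ideal.Quotient.mk (M ^ n) (Φ x) = q n (AdicCompletion.evalₐ m n x) :=
    IsAdicComplete.mk_liftRingHom M f hf n x
  have haus {x y : T} (h : ∀ n, Ideal.Quotient.mk (M ^ n) x = Ideal.Quotient.mk (M ^ n) y) :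
      x = y := by
    rw [← sub_eq_zero]
    refine IsHausdorff.haus (I := M) inferInstance _ fun n ↦ ?_
    rw [SModEq.zero, smul_eq_mul, Ideal.mul_top]
    exact Ideal.Quotient.eq.1 (h n)
  have hbij : Function.Bijective Φ := by
    refine ⟨(injective_iff_map_eq_zero Φ).2 fun x hx ↦ ?_, fun t ↦ ?_⟩
    · refine AdicCompletion.ext_evalₐ fun n ↦ hq n ?_
      rw [← hΦ, hx, map_zero, map_zero, map_zero]
    · choose a ha using fun n ↦ hdense n t
      refine ⟨AdicCompletion.mk m R (AdicCompletion.AdicCauchySequence.mk m R a fun n ↦ ?_), ?_⟩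
      · rw [SModEq.sub_mem, smul_eq_mul, Ideal.mul_top, ← hcomap, Ideal.mem_comap, map_sub]
        convert sub_mem (ha n) (Ideal.pow_le_pow_right n.le_succ (ha (n + 1))) using 1
        simp
      · refine haus fun n ↦ ?_
        rw [hΦ, AdicCompletion.evalₐ_mk]
        exact Ideal.Quotient.eq.2 (ha n)
  refine ⟨{ RingEquiv.ofBijective Φ hbij with commutes' := fun r ↦ haus fun n ↦ ?_ }⟩
  change Ideal.Quotient.mk (M ^ n) (Φ _) = _
  rw [hΦ, AlgHom.commutes]
  rfl

/-- An ideal not contained in any associated prime contains a regular element. -/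
lemma exists_mem_nonZeroDivisors {T : Type*} [CommRing T] [IsNoetherianRing T] {I : Ideal T}
    (hI : ∀ Q ∈ associatedPrimes T T, ¬ I ≤ Q) : ∃ a ∈ I, a ∈ nonZeroDivisors T := by
  by_contra! h
  have hsub : (I : Set T) ⊆ ⋃ Q ∈ associatedPrimes T T, (Q : Set T) := by
    rw [biUnion_associatedPrimes_eq_compl_nonZeroDivisors]
    exact h
  obtain ⟨Q, hQ, hle⟩ := (Ideal.subset_union_prime_finite (associatedPrimes.finite T T) ⊤ ⊤
    (fun Q hQ _ _ ↦ hQ.isPrime)).1 hsub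
  exact hI Q hQ hle

/-- Nakayama's lemma for generators of an ideal lying in a subring. -/
lemma map_comap_subtype_eq {T : Type*} [CommRing T] [IsLocalRing T] [IsNoetherianRing T]
    {R : Subring T} {I : Ideal T} {s : Set T} (hs : Ideal.span s = I)
    (h : ∀ z ∈ s, ∃ r ∈ R, r - z ∈ maximalIdeal T * I) :
    (I.comap R.subtype).map R.subtype = I := by
  refine le_antisymm Ideal.map_comap_le ?_
  refine Submodule.le_of_le_smul_of_le_jacobson_bot (I := maximalIdeal T)
    (IsNoetherian.noetherian I) (maximalIdeal_le_jacobson _) ?_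
  nth_rw 1 [← hs]
  rw [Ideal.span_le]
  intro z hz
  obtain ⟨r, hr, hrz⟩ := h z hz
  have hzI : z ∈ I := hs ▸ Ideal.subset_span hz
  have hrI : r ∈ I := by
    have h0 : maximalIdeal T * I ≤ I := Ideal.mul_le_right
    have h1 : r - z ∈ I := h0 hrz
    have h2 := I.add_mem h1 hzI
    rwa [sub_add_cancel] at h2
  rw [← sub_sub_cancel r z]
  refine sub_mem (Ideal.mem_sup_left ?_) (Ideal.mem_sup_right hrz)
  have : (⟨r, hr⟩ : R) ∈ I.comap R.subtype := hrI
  exact Ideal.mem_map_of_mem R.subtype this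

open Cardinal in
/-- A complete local ring satisfying the necessary conditions is the completion of a local domain,
which can be chosen so that a given prime ideal containing a regular element is extended. -/
lemma exists_subring_adicCompletion {T : Type} [CommRing T] [IsLocalRing T] [IsNoetherianRing T]
    [IsAdicComplete (maximalIdeal T) T]
    (hT : ∀ z : ℤ, (z : T) ≠ 0 → (z : T) ∈ nonZeroDivisors T)
    (hM : maximalIdeal T ∉ associatedPrimes T T) (q : Ideal T)
    (hq : ∃ a ∈ q, a ∈ nonZeroDivisors T) :
    ∃ (R : Subring T) (_ : IsDomain R) (_ : IsLocalRing R) (_ : IsNoetherianRing R),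
      (q.comap R.subtype).map R.subtype = q ∧
      (maximalIdeal R).map R.subtype = maximalIdeal T ∧
      Nonempty (AdicCompletion (maximalIdeal R) R ≃ₐ[R] T) := by
  have hM' : ∃ a ∈ maximalIdeal T, a ∈ nonZeroDivisors T := exists_mem_nonZeroDivisors
    fun Q hQ hle ↦ hM <| by
      have := hQ.isPrime
      rwa [(maximalIdeal.isMaximal T).eq_of_le this.ne_top hle]
  have hprod (I : Ideal T) (hI : ∃ a ∈ I, a ∈ nonZeroDivisors T) :
      ∃ a ∈ maximalIdeal T * I, a ∈ nonZeroDivisors T := by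
    obtain ⟨a, ha, ha'⟩ := hM'
    obtain ⟨b, hb, hb'⟩ := hI
    exact ⟨a * b, Ideal.mul_mem_mul ha hb, mul_mem ha' hb'⟩
  obtain ⟨sM, hsM⟩ := IsNoetherian.noetherian (maximalIdeal T)
  obtain ⟨sq, hsq⟩ := IsNoetherian.noetherian q
  let z : ResidueField T ⊕ sM ⊕ sq → T :=
    Sum.elim (Function.surjInv residue_surjective) (Sum.elim Subtype.val Subtype.val)
  let J : ResidueField T ⊕ sM ⊕ sq → Ideal T :=
    Sum.elim (fun _ ↦ maximalIdeal T) (Sum.elim (fun _ ↦ maximalIdeal T * maximalIdeal T)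
      fun _ ↦ maximalIdeal T * q)
  have hc : ℵ₀ ≤ max #(ResidueField T) ℵ₁ :=
    aleph0_lt_aleph_one.le.trans (le_max_right _ _)
  obtain ⟨R, hreg, hcl, hR⟩ := exists_regular_subring hT hM' (ι := ResidueField T ⊕ sM ⊕ sq)
    (by
      simp only [mk_sum, lift_id]
      refine add_le_of_le hc (le_max_left _ _) (add_le_of_le hc ?_ ?_) <;>
      exact (lt_aleph0_of_finite _).le.trans hc) z J (by
      rintro (i | i | i)
      exacts [hM', hprod _ hM', hprod _ hq])
  have := hcl.isLocalHom
  have hloc : IsLocalRing R := RingHom.domain_isLocalRing R.subtype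
  have hmax : (maximalIdeal T).comap R.subtype = maximalIdeal R :=
    ((local_hom_TFAE R.subtype).out 0 4).1 this
  have hmap : (maximalIdeal R).map R.subtype = maximalIdeal T := by
    rw [← hmax]
    exact map_comap_subtype_eq hsM fun x hx ↦ hR (.inr (.inl ⟨x, hx⟩))
  refine ⟨R, hreg.isDomain, hloc, hcl.isNoetherianRing,
    map_comap_subtype_eq hsq fun x hx ↦ hR (.inr (.inr ⟨x, hx⟩)), hmap,
    nonempty_adicCompletion_algEquiv hcl hmap fun t ↦ ?_⟩
  obtain ⟨r, hr, hrt⟩ := hR (.inl (residue T t))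
  refine ⟨r, hr, ?_⟩
  change r - Function.surjInv residue_surjective (residue T t) ∈ maximalIdeal T at hrt
  rw [← residue_eq_zero_iff, map_sub, sub_eq_zero] at hrt ⊢
  rw [hrt]
  exact Function.surjInv_eq residue_surjective _

section FlatLocal

open PrimeSpectrum

lemma PrimeSpectrum.covBy_of_mem_minimalPrimes {R : Type*} [CommRing R] [IsNoetherianRing R]
    {p q : PrimeSpectrum R} (hpq : p < q) {x : R}
    (h : q.asIdeal ∈ (p.asIdeal ⊔ Ideal.span {x}).minimalPrimes) : p ⋖ q := by
  refine ⟨hpq, fun c hpc hcq => ?_⟩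
  have hsurj := Ideal.Quotient.mk_surjective (I := p.asIdeal)
  have hker : ∀ r : PrimeSpectrum R, p ≤ r → RingHom.ker (Ideal.Quotient.mk p.asIdeal) ≤ r.asIdeal :=
    fun r hr => by rw [Ideal.mk_ker]; exact hr
  have hcomap : ∀ r : PrimeSpectrum R, p ≤ r →
      (r.asIdeal.map (Ideal.Quotient.mk p.asIdeal)).comap (Ideal.Quotient.mk p.asIdeal) =
        r.asIdeal := fun r hr => by
    rw [Ideal.comap_map_of_surjective _ hsurj]
    exact sup_eq_left.2 (hker r hr)
  have hprime : ∀ r : PrimeSpectrum R, p ≤ r →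
      (r.asIdeal.map (Ideal.Quotient.mk p.asIdeal)).IsPrime := fun r hr =>
    Ideal.map_isPrime_of_surjective hsurj (hker r hr)
  have hlt : ∀ r s : PrimeSpectrum R, p ≤ r → r < s →
      r.asIdeal.map (Ideal.Quotient.mk p.asIdeal) < s.asIdeal.map (Ideal.Quotient.mk p.asIdeal) := by
    intro r s hr hrs
    refine lt_of_le_of_ne (Ideal.map_mono hrs.le) fun he => hrs.ne ?_
    ext1
    rw [← hcomap r hr, he, hcomap s (hr.trans hrs.le)]
  have := hprime p le_rfl
  have := hprime c hpc.le
  have := hprime q hpq.le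
  have h1 := Ideal.map_height_le_one_of_mem_minimalPrimes h
  have h2 := Ideal.height_add_one_le_of_lt_of_isPrime (hlt c q hpc.le hcq)
  have h3 := Ideal.height_add_one_le_of_lt_of_isPrime (hlt p c le_rfl hpc)
  have h4 : (1 : ℕ∞) + 1 ≤ 1 := le_trans (by gcongr; exact le_trans le_add_self h3) (h2.trans h1)
  exact absurd h4 (by decide)

lemma PrimeSpectrum.coheight_ne_top {R : Type*} [CommRing R] [IsLocalRing R] [IsNoetherianRing R]
    (p : PrimeSpectrum R) : Order.coheight p ≠ ⊤ := by
  intro h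
  have h1 := Order.coheight_le_krullDim p
  have h2 : Order.krullDim (PrimeSpectrum R) < ⊤ := ringKrullDim_lt_top
  rw [h] at h1
  exact absurd (h1.trans_lt h2) (lt_irrefl _)

lemma PrimeSpectrum.exists_minimalPrimes_le {R : Type*} [CommRing R] {I : Ideal R}
    {q : PrimeSpectrum R} (h : I ≤ q.asIdeal) :
    ∃ p : PrimeSpectrum R, p.asIdeal ∈ I.minimalPrimes ∧ p ≤ q := by
  obtain ⟨p, hp, hpq⟩ := Ideal.exists_minimalPrimes_le h
  exact ⟨⟨p, hp.isPrime⟩, hp, hpq⟩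

lemma PrimeSpectrum.coheight_eq_ringKrullDim_quotient {R : Type*} [CommRing R]
    (p : PrimeSpectrum R) : (Order.coheight p : WithBot ℕ∞) = ringKrullDim (R ⧸ p.asIdeal) := by
  rw [ringKrullDim_quotient, Order.coheight_eq_krullDim_Ici]
  rfl

variable {A T : Type*} [CommRing A] [CommRing T] [Algebra A T] [Module.Flat A T]

lemma exists_comap_eq_of_le {a : PrimeSpectrum A} {Q : PrimeSpectrum T}
    (h : a ≤ comap (algebraMap A T) Q) :
    ∃ Q' : PrimeSpectrum T, Q' ≤ Q ∧ comap (algebraMap A T) Q' = a := by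
  obtain ⟨P, hP, hP', hPa⟩ := Ideal.exists_ideal_le_liesOver_of_le (p := a.asIdeal)
    (q := Q.asIdeal.under A) Q.asIdeal h
  exact ⟨⟨P, hP'⟩, hP, PrimeSpectrum.ext hPa.over.symm⟩

lemma comap_eq_of_mem_minimalPrimes_map {a : PrimeSpectrum A} {Q : PrimeSpectrum T}
    (h : Q.asIdeal ∈ (a.asIdeal.map (algebraMap A T)).minimalPrimes) :
    comap (algebraMap A T) Q = a := by
  obtain ⟨Q', hle, rfl⟩ := exists_comap_eq_of_le (a := a)
    (Ideal.map_le_iff_le_comap.1 h.1.2)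
  rw [show Q = Q' from le_antisymm (h.2 ⟨Q'.2, Ideal.map_comap_le⟩ hle) hle]

lemma covBy_of_mem_minimalPrimes_map [IsNoetherianRing T] {a b : PrimeSpectrum A} (hab : a ⋖ b)
    {P Q : PrimeSpectrum T} (hP : P.asIdeal ∈ (a.asIdeal.map (algebraMap A T)).minimalPrimes)
    (hQ : Q.asIdeal ∈ (b.asIdeal.map (algebraMap A T)).minimalPrimes) (hPQ : P ≤ Q) : P ⋖ Q := by
  have hPa := comap_eq_of_mem_minimalPrimes_map hP
  have hQb := comap_eq_of_mem_minimalPrimes_map hQ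
  obtain ⟨x, hxb, hxa⟩ := SetLike.exists_of_lt (show a.asIdeal < b.asIdeal from hab.lt)
  refine PrimeSpectrum.covBy_of_mem_minimalPrimes (x := algebraMap A T x)
    (lt_of_le_of_ne hPQ ?_) ⟨⟨Q.2, sup_le hPQ ?_⟩, ?_⟩
  · rintro rfl
    exact hab.lt.ne (hPa.symm.trans hQb)
  · rw [Ideal.span_singleton_le_iff_mem]
    exact hQ.1.2 (Ideal.mem_map_of_mem _ hxb)
  · rintro J ⟨hJ, hle⟩ hJQ
    refine hQ.2 ⟨hJ, Ideal.map_le_iff_le_comap.2 ?_⟩ hJQ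
    let J' : PrimeSpectrum T := ⟨J, hJ⟩
    have h1 : a ≤ comap (algebraMap A T) J' := by
      rw [← hPa]
      exact Ideal.comap_mono (le_sup_left.trans hle)
    have h2 : comap (algebraMap A T) J' ≤ b := by
      rw [← hQb]
      exact Ideal.comap_mono hJQ
    have h3 : a ≠ comap (algebraMap A T) J' := by
      intro h
      apply hxa
      rw [h]
      exact hle (Ideal.mem_sup_right (Ideal.mem_span_singleton_self _))
    exact ((hab.eq_or_eq h1 h2).resolve_left h3.symm).ge

lemma exists_coheight_le_of_isLocalHom [IsLocalRing A] [IsNoetherianRing A] [IsLocalRing T]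
    [IsLocalHom (algebraMap A T)] (a : PrimeSpectrum A) :
    ∃ Q : PrimeSpectrum T, Q.asIdeal ∈ (a.asIdeal.map (algebraMap A T)).minimalPrimes ∧
      Order.coheight a ≤ Order.coheight Q := by
  have key : ∀ n : ℕ, ∀ a : PrimeSpectrum A, Order.coheight a = n →
      ∃ Q : PrimeSpectrum T, comap (algebraMap A T) Q = a ∧ n ≤ Order.coheight Q := by
    intro n
    induction n with
    | zero =>
      intro a ha
      refine ⟨⊤, ?_, by simp⟩
      rw [Nat.cast_zero, Order.coheight_eq_zero, isMax_iff_eq_top] at ha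
      rw [ha]
      exact comap_closedPoint _
    | succ n ih =>
      intro a ha
      obtain ⟨-, ⟨b, hab, hb⟩, -⟩ := Order.coheight_eq_coe_add_one_iff.1
        (show Order.coheight a = n + 1 by exact_mod_cast ha)
      obtain ⟨Q, rfl, hQ⟩ := ih b hb
      obtain ⟨P, hPQ, rfl⟩ := exists_comap_eq_of_le hab.le
      refine ⟨P, rfl, ?_⟩
      have hlt : P < Q := lt_of_le_of_ne hPQ (by rintro rfl; exact lt_irrefl _ hab)
      push_cast
      exact le_trans (by gcongr) (Order.coheight_add_one_le hlt)
  obtain ⟨n, hn⟩ := ENat.ne_top_iff_exists.1 (coheight_ne_top a)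
  obtain ⟨Q, rfl, hQ⟩ := key n a hn.symm
  obtain ⟨P, hP, hPQ⟩ := PrimeSpectrum.exists_minimalPrimes_le
    (I := ((comap (algebraMap A T) Q).asIdeal.map (algebraMap A T))) (q := Q) Ideal.map_comap_le
  exact ⟨P, hP, hn ▸ hQ.trans (Order.coheight_anti hPQ)⟩

lemma ringKrullDim_le_of_map_maximalIdeal_eq {B S : Type*} [CommRing B] [CommRing S]
    [IsLocalRing B] [IsNoetherianRing B] [IsLocalRing S] [IsNoetherianRing S] [Algebra B S]
    (h : (maximalIdeal B).map (algebraMap B S) = maximalIdeal S) :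
    ringKrullDim S ≤ ringKrullDim B := by
  have : (maximalIdeal S).LiesOver (maximalIdeal B) := by
    refine ⟨?_⟩
    refine ((maximalIdeal.isMaximal B).eq_of_le (Ideal.comap_ne_top _
      (maximalIdeal.isMaximal S).ne_top) ?_)
    rw [← Ideal.map_le_iff_le_comap, h]
  have h1 := Ideal.height_le_height_add_of_liesOver (maximalIdeal B) (maximalIdeal S)
  have : Nontrivial (S ⧸ (maximalIdeal B).map (algebraMap B S)) := by
    rw [h]
    infer_instance
  have h2 : ((maximalIdeal S).map
      (Ideal.Quotient.mk ((maximalIdeal B).map (algebraMap B S)))).height = 0 := by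
    rw [← h, Ideal.map_quotient_self, Ideal.height_bot]
  rw [h2, add_zero] at h1
  rw [← maximalIdeal_height_eq_ringKrullDim, ← maximalIdeal_height_eq_ringKrullDim]
  exact_mod_cast h1

lemma coheight_le_of_map_le {A T : Type*} [CommRing A] [CommRing T] [Algebra A T]
    [IsLocalRing A] [IsNoetherianRing A] [IsLocalRing T]
    [IsNoetherianRing T] (hm : (maximalIdeal A).map (algebraMap A T) = maximalIdeal T)
    {a : PrimeSpectrum A} {Q : PrimeSpectrum T}
    (h : a.asIdeal.map (algebraMap A T) ≤ Q.asIdeal) :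
    Order.coheight Q ≤ Order.coheight a := by
  have := IsLocalRing.of_surjective' _ (Ideal.Quotient.mk_surjective (I := a.asIdeal))
  have := IsLocalRing.of_surjective' _ (Ideal.Quotient.mk_surjective (I := Q.asIdeal))
  let φ : A ⧸ a.asIdeal →+* T ⧸ Q.asIdeal :=
    Ideal.quotientMap Q.asIdeal (algebraMap A T) (Ideal.map_le_iff_le_comap.1 h)
  let := φ.toAlgebra
  have hφ : (maximalIdeal (A ⧸ a.asIdeal)).map (algebraMap (A ⧸ a.asIdeal) (T ⧸ Q.asIdeal)) =
      maximalIdeal (T ⧸ Q.asIdeal) := by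
    rw [← IsLocalRing.map_maximalIdeal_of_surjective _ (Ideal.Quotient.mk_surjective (I := a.asIdeal)),
      ← IsLocalRing.map_maximalIdeal_of_surjective _ (Ideal.Quotient.mk_surjective (I := Q.asIdeal)),
      ← hm, Ideal.map_map, Ideal.map_map]
    congr 1
  have := ringKrullDim_le_of_map_maximalIdeal_eq hφ
  rw [← coheight_eq_ringKrullDim_quotient, ← coheight_eq_ringKrullDim_quotient] at this
  exact_mod_cast this

lemma exists_coheight_eq_add [IsNoetherianRing A] [IsNoetherianRing T]
    (hcov : ∀ p q : PrimeSpectrum T, p ⋖ q → Order.coheight p = Order.coheight q + 1)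
    (a : PrimeSpectrum A) :
    ∃ l : ℕ, ∀ Q : PrimeSpectrum T, Q.asIdeal ∈ (a.asIdeal.map (algebraMap A T)).minimalPrimes →
      ∃ P : PrimeSpectrum T, P.asIdeal ∈ minimalPrimes T ∧ P ≤ Q ∧
        Order.coheight P = Order.coheight Q + l := by
  have key : ∀ n : ℕ, ∀ a : PrimeSpectrum A, Order.height a = n →
      ∃ l : ℕ, ∀ Q : PrimeSpectrum T, Q.asIdeal ∈ (a.asIdeal.map (algebraMap A T)).minimalPrimes →
        ∃ P : PrimeSpectrum T, P.asIdeal ∈ minimalPrimes T ∧ P ≤ Q ∧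
          Order.coheight P = Order.coheight Q + l := by
    intro n
    induction n with
    | zero =>
      intro a ha
      refine ⟨0, fun Q hQ => ?_⟩
      obtain ⟨P, hP, hPQ⟩ := PrimeSpectrum.exists_minimalPrimes_le (I := ⊥) (q := Q) bot_le
      have h1 : comap (algebraMap A T) P ≤ a := by
        rw [← comap_eq_of_mem_minimalPrimes_map hQ]
        exact Ideal.comap_mono hPQ
      rw [Nat.cast_zero, Order.height_eq_zero] at ha
      have h2 : Q ≤ P := hQ.2 ⟨P.2, Ideal.map_le_iff_le_comap.2 (ha h1)⟩ hPQ
      exact ⟨P, hP, hPQ, by rw [le_antisymm hPQ h2]; simp⟩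
    | succ n ih =>
      intro a ha
      obtain ⟨hfin, ⟨b, hba, hb⟩, -⟩ := Order.height_eq_coe_add_one_iff.1
        (show Order.height a = n + 1 by exact_mod_cast ha)
      have hcb : b ⋖ a := by
        refine ⟨hba, fun c hbc hca => ?_⟩
        have h1 := Order.height_add_one_le hbc
        have h2 := Order.height_add_one_le hca
        rw [hb] at h1
        rw [ha] at h2
        have h3 : ((n + 1 + 1 : ℕ) : ℕ∞) ≤ (n + 1 : ℕ) := by
          push_cast at h2 ⊢
          exact le_trans (by gcongr) h2
        exact absurd (Nat.cast_le.1 h3) (by omega)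
      obtain ⟨l, hl⟩ := ih b hb
      refine ⟨l + 1, fun Q hQ => ?_⟩
      obtain ⟨Q', hQ', hle⟩ := PrimeSpectrum.exists_minimalPrimes_le
        ((Ideal.map_mono hba.le).trans hQ.1.2)
      obtain ⟨P, hP, hPQ, h⟩ := hl Q' hQ'
      refine ⟨P, hP, hPQ.trans hle, ?_⟩
      rw [h, hcov _ _ (covBy_of_mem_minimalPrimes_map hcb hQ' hQ hle)]
      push_cast
      ring
  have hfin : Order.height a ≠ ⊤ := by
    rw [← PrimeSpectrum.height_eq_orderHeight]
    exact Ideal.height_ne_top_of_isPrime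
  obtain ⟨n, hn⟩ := ENat.ne_top_iff_exists.1 hfin
  exact key n a hn.symm

lemma isLocalHom_of_map_maximalIdeal_le {A T : Type*} [CommRing A] [CommRing T] [Algebra A T]
    [IsLocalRing A] [IsLocalRing T]
    (hm : (maximalIdeal A).map (algebraMap A T) ≤ maximalIdeal T) :
    IsLocalHom (algebraMap A T) :=
  ((local_hom_TFAE (algebraMap A T)).out 2 0).1 hm

lemma coheight_eq_of_forall_minimalPrimes [IsDomain A] [IsLocalRing A] [IsNoetherianRing A]
    [IsLocalRing T] [IsNoetherianRing T]
    (hm : (maximalIdeal A).map (algebraMap A T) = maximalIdeal T)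
    (hcov : ∀ p q : PrimeSpectrum T, p ⋖ q → Order.coheight p = Order.coheight q + 1)
    (hT : ∀ P : PrimeSpectrum T, P.asIdeal ∈ minimalPrimes T → 1 < Order.coheight P →
      ∀ P' : PrimeSpectrum T, Order.coheight P' ≤ Order.coheight P)
    {a b : PrimeSpectrum A} (hab : a ⋖ b) : Order.coheight a = Order.coheight b + 1 := by
  have := isLocalHom_of_map_maximalIdeal_le hm.le
  refine le_antisymm ?_ (Order.coheight_add_one_le hab.lt)
  by_contra! hlt
  obtain ⟨Qa, hQa, ha⟩ := exists_coheight_le_of_isLocalHom (T := T) a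
  obtain ⟨Qb, hQb, hb⟩ := exists_coheight_le_of_isLocalHom (T := T) b
  replace hb := le_antisymm (coheight_le_of_map_le hm hQb.1.2) hb
  obtain ⟨Q, hQ, hle⟩ := PrimeSpectrum.exists_minimalPrimes_le
    ((Ideal.map_mono hab.le).trans hQb.1.2)
  have hQc := hcov _ _ (covBy_of_mem_minimalPrimes_map hab hQ hQb hle)
  obtain ⟨l, hl⟩ := exists_coheight_eq_add hcov a
  obtain ⟨P, hP, hPQ, h⟩ := hl Q hQ
  obtain ⟨P', hP', hPQ', h'⟩ := hl Qa hQa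
  obtain ⟨i, hi⟩ := ENat.ne_top_iff_exists.1 (coheight_ne_top a)
  obtain ⟨j, hj⟩ := ENat.ne_top_iff_exists.1 (coheight_ne_top b)
  obtain ⟨k, hk⟩ := ENat.ne_top_iff_exists.1 (coheight_ne_top Qa)
  obtain ⟨r, hr⟩ := ENat.ne_top_iff_exists.1 (coheight_ne_top P)
  rw [← hk, ← hi] at ha
  rw [hQc, hb, ← hj, ← hr] at h
  rw [← hk] at h'
  rw [← hj, ← hi] at hlt
  norm_cast at ha h hlt
  by_cases h1 : 1 < r
  · have := hT P hP (by rw [← hr]; exact_mod_cast h1) P'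
    rw [h', ← hr] at this
    norm_cast at this
    omega
  · have hj0 : j = 0 := by omega
    have hPQ0 : P = Q := by
      by_contra hne
      have := Order.coheight_add_one_le (lt_of_le_of_ne hPQ hne)
      rw [hQc, hb, ← hj, ← hr] at this
      norm_cast at this
      omega
    have hb0 : b = ⊤ := by
      rw [← isMax_iff_eq_top, ← Order.coheight_eq_zero, ← hj, hj0, Nat.cast_zero]
    have ha0 : a = ⊥ := by
      obtain ⟨P₀, hP₀, hc⟩ := exists_comap_eq_of_le (A := A) (a := ⊥) (Q := P) bot_le
      have : P = P₀ := le_antisymm (hP.2 ⟨P₀.2, bot_le⟩ hP₀) hP₀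
      rw [← comap_eq_of_mem_minimalPrimes_map hQ, ← hPQ0, this, hc]
    have : Order.coheight a ≤ (1 : ℕ) := by
      rw [Order.coheight_le_coe_iff]
      intro y hy
      have : y = ⊤ := by
        rcases hab.eq_or_eq hy.le (hb0 ▸ le_top) with h | h
        · exact absurd h hy.ne'
        · rw [h, hb0]
      rw [this]
      simp
    rw [← hi] at this
    norm_cast at this
    omega

lemma isSaturatedChain_cons {A : Type} [CommRing A] {n : ℕ} {f : Fin (n + 1) → PrimeSpectrum A}
    (hf : IsSaturatedChain f) {a : PrimeSpectrum A} (ha : a ⋖ f 0) :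
    IsSaturatedChain (Fin.cons a f : Fin (n + 1 + 1) → PrimeSpectrum A) := by
  intro i
  cases i using Fin.cases with
  | zero => simpa using ha
  | succ i => simpa [← Fin.succ_castSucc] using hf i

lemma isCatenary_of_coheight {A : Type} [CommRing A] [IsLocalRing A] [IsNoetherianRing A]
    (h : ∀ a b : PrimeSpectrum A, a ⋖ b → Order.coheight a = Order.coheight b + 1) :
    IsCatenary A := by
  have key : ∀ (n : ℕ) (f : Fin (n + 1) → PrimeSpectrum A), IsSaturatedChain f →
      Order.coheight (f 0) = Order.coheight (f (Fin.last n)) + n := by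
    intro n f hf
    have : ∀ i : Fin (n + 1), Order.coheight (f 0) = Order.coheight (f i) + (i : ℕ) := by
      intro i
      induction i using Fin.induction with
      | zero => simp
      | succ i ih =>
        rw [ih, h _ _ (hf i)]
        simp only [Fin.val_castSucc, Fin.val_succ]
        push_cast
        ring
    exact this (Fin.last n)
  intro n m f g hf hg h0 hl
  have h1 := key n f hf
  rw [h0, key m g hg, hl] at h1
  obtain ⟨k, hk⟩ := ENat.ne_top_iff_exists.1 (coheight_ne_top (g (Fin.last m)))
  rw [← hk] at h1
  norm_cast at h1
  omega

lemma exists_isSaturatedChain {A : Type} [CommRing A] [IsLocalRing A] (n : ℕ) :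
    ∀ a : PrimeSpectrum A, Order.coheight a = n →
      ∃ f : Fin (n + 1) → PrimeSpectrum A, IsSaturatedChain f ∧ f 0 = a ∧ f (Fin.last n) = ⊤ := by
  induction n with
  | zero =>
    intro a ha
    rw [Nat.cast_zero, Order.coheight_eq_zero, isMax_iff_eq_top] at ha
    exact ⟨fun _ => a, fun i => i.elim0, rfl, ha⟩
  | succ n ih =>
    intro a ha
    obtain ⟨-, ⟨b, hab, hb⟩, -⟩ := Order.coheight_eq_coe_add_one_iff.1
      (show Order.coheight a = n + 1 by exact_mod_cast ha)
    have hcov : a ⋖ b := by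
      refine ⟨hab, fun c hac hcb => ?_⟩
      have h1 := Order.coheight_add_one_le hac
      have h2 := Order.coheight_add_one_le hcb
      rw [ha] at h1
      rw [hb] at h2
      have h3 : ((n + 1 + 1 : ℕ) : ℕ∞) ≤ (n + 1 : ℕ) := by
        push_cast at h1 ⊢
        exact le_trans (by gcongr) h1
      exact absurd (Nat.cast_le.1 h3) (by omega)
    obtain ⟨f, hf, h0, hl⟩ := ih b hb
    exact ⟨Fin.cons a f, isSaturatedChain_cons hf (h0 ▸ hcov), rfl, by
      rw [← Fin.succ_last, Fin.cons_succ, hl]⟩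

lemma not_isCatenary_of_coheight_lt {A : Type} [CommRing A] [IsLocalRing A] [IsNoetherianRing A]
    {a b : PrimeSpectrum A} (hab : a ⋖ b) (h : Order.coheight b + 1 < Order.coheight a) :
    ¬ IsCatenary A := by
  intro hA
  obtain ⟨n, hn⟩ := ENat.ne_top_iff_exists.1 (coheight_ne_top a)
  obtain ⟨m, hm⟩ := ENat.ne_top_iff_exists.1 (coheight_ne_top b)
  obtain ⟨f, hf, hf0, hfl⟩ := exists_isSaturatedChain n a hn.symm
  obtain ⟨g, hg, hg0, hgl⟩ := exists_isSaturatedChain m b hm.symm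
  have := hA n (m + 1) f (Fin.cons a g) hf (isSaturatedChain_cons hg (hg0 ▸ hab)) hf0
    (by rw [← Fin.succ_last, Fin.cons_succ, hgl, hfl])
  rw [← hn, ← hm] at h
  norm_cast at h
  omega

/-- A minimal prime of coheight at least two is covered by a prime that contains a
non-zero-divisor and no other minimal prime. -/
lemma exists_covBy_of_mem_minimalPrimes {T : Type*} [CommRing T] [IsLocalRing T]
    [IsNoetherianRing T] (hM : maximalIdeal T ∉ associatedPrimes T T)
    (hcov : ∀ p q : PrimeSpectrum T, p ⋖ q → Order.coheight p = Order.coheight q + 1)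
    {P : PrimeSpectrum T} (hP : P.asIdeal ∈ minimalPrimes T) (hP1 : 1 < Order.coheight P) :
    ∃ q : PrimeSpectrum T, P ⋖ q ∧ (∃ y ∈ q.asIdeal, y ∈ nonZeroDivisors T) ∧
      ∀ P' : PrimeSpectrum T, P'.asIdeal ∈ minimalPrimes T → P' ≤ q → P' = P := by
  classical
  have hass : minimalPrimes T ⊆ associatedPrimes T T := by
    have := Module.associatedPrimes.minimalPrimes_annihilator_subset_associatedPrimes (R := T) (M := T)
    rwa [(Module.annihilator_eq_bot (R := T) (M := T)).2 inferInstance] at this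
  have hfin := associatedPrimes.finite T T
  obtain ⟨x, hx, hxP⟩ : ∃ x, (∀ Q ∈ associatedPrimes T T, Q ≠ P.asIdeal → x ∈ Q) ∧
      x ∉ P.asIdeal := by
    let s := hfin.toFinset.erase P.asIdeal
    have : ¬ s.inf id ≤ P.asIdeal := by
      rw [P.2.inf_le']
      rintro ⟨Q, hQ, hle⟩
      simp only [s, Finset.mem_erase, Set.Finite.mem_toFinset] at hQ
      have := hQ.2.isPrime
      exact hQ.1 (le_antisymm hle (hP.2 ⟨this, bot_le⟩ hle))
    obtain ⟨x, hx, hxP⟩ := SetLike.not_le_iff_exists.1 this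
    refine ⟨x, fun Q hQ hne => ?_, hxP⟩
    rw [Submodule.mem_finsetInf] at hx
    exact hx Q (by simp [s, hQ, hne])
  have hlt : ∀ q : PrimeSpectrum T, q.asIdeal ∈ (P.asIdeal ⊔ Ideal.span {x}).minimalPrimes →
      P < q := fun q hq => by
    refine lt_of_le_of_ne (le_sup_left.trans hq.1.2) ?_
    rintro rfl
    exact hxP (hq.1.2 (Ideal.mem_sup_right (Ideal.mem_span_singleton_self x)))
  have hfin' := hfin.union (Ideal.finite_minimalPrimes_of_isNoetherianRing T
    (P.asIdeal ⊔ Ideal.span {x}))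
  obtain ⟨y, hyM, hy⟩ : ∃ y ∈ maximalIdeal T, ∀ Q ∈ associatedPrimes T T ∪
      (P.asIdeal ⊔ Ideal.span {x}).minimalPrimes, y ∉ Q := by
    by_contra! h
    have hsub : (maximalIdeal T : Set T) ⊆ ⋃ Q ∈ associatedPrimes T T ∪
        (P.asIdeal ⊔ Ideal.span {x}).minimalPrimes, (Q : Set T) := fun y hy => by
      obtain ⟨Q, hQ, hyQ⟩ := h y hy
      exact Set.mem_biUnion hQ hyQ
    obtain ⟨Q, hQ, hle⟩ := (Ideal.subset_union_prime_finite hfin' ⊤ ⊤ (by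
      rintro Q (hQ | hQ) _ _
      exacts [hQ.isPrime, hQ.isPrime])).1 hsub
    have hQp : Q.IsPrime := by
      rcases hQ with hQ | hQ
      exacts [hQ.isPrime, hQ.isPrime]
    obtain rfl := (maximalIdeal.isMaximal T).eq_of_le hQp.ne_top hle
    refine hQ.elim hM fun hQ => ?_
    have hc := PrimeSpectrum.covBy_of_mem_minimalPrimes (q := ⊤) (hlt ⊤ hQ) hQ
    rw [hcov _ _ hc, Order.coheight_top, zero_add] at hP1
    exact lt_irrefl _ hP1
  have hyreg : y ∈ nonZeroDivisors T := by
    by_contra h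
    have : y ∈ ((nonZeroDivisors T : Set T))ᶜ := h
    rw [← biUnion_associatedPrimes_eq_compl_nonZeroDivisors] at this
    obtain ⟨Q, hQ, hyQ⟩ := Set.mem_iUnion₂.1 this
    exact hy Q (Or.inl hQ) hyQ
  obtain ⟨q, hq, -⟩ := PrimeSpectrum.exists_minimalPrimes_le (I := P.asIdeal ⊔ Ideal.span {y})
    (q := ⊤) (sup_le (le_maximalIdeal P.2.ne_top)
      ((Ideal.span_singleton_le_iff_mem _).2 hyM))
  have hyq : y ∈ q.asIdeal := hq.1.2 (Ideal.mem_sup_right (Ideal.mem_span_singleton_self y))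
  have hPq : P < q := by
    refine lt_of_le_of_ne (le_sup_left.trans hq.1.2) ?_
    rintro rfl
    exact hy _ (Or.inl (hass hP)) hyq
  have hc := PrimeSpectrum.covBy_of_mem_minimalPrimes hPq hq
  refine ⟨q, hc, ⟨y, hyq, hyreg⟩, fun P' hP' hle => ?_⟩
  by_contra hne
  have hxq : x ∈ q.asIdeal := hle (hx _ (hass hP') fun h => hne (PrimeSpectrum.ext h))
  obtain ⟨q', hq', hle'⟩ := PrimeSpectrum.exists_minimalPrimes_le
    (I := P.asIdeal ⊔ Ideal.span {x}) (q := q)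
    (sup_le hPq.le ((Ideal.span_singleton_le_iff_mem _).2 hxq))
  obtain rfl := (hc.eq_or_eq (hlt q' hq').le hle').resolve_left (hlt q' hq').ne'
  exact hy _ (Or.inr hq') hyq

lemma exists_minimalPrimes_of_not_isCatenary {A T : Type} [CommRing A] [IsDomain A]
    [IsLocalRing A] [IsNoetherianRing A] [CommRing T] [IsLocalRing T] [IsNoetherianRing T]
    [Algebra A T] [Module.Flat A T]
    (hm : (maximalIdeal A).map (algebraMap A T) = maximalIdeal T)
    (hcov : ∀ p q : PrimeSpectrum T, p ⋖ q → Order.coheight p = Order.coheight q + 1)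
    (hA : ¬ IsCatenary A) :
    (∀ z : ℤ, (z : T) ≠ 0 → (z : T) ∈ nonZeroDivisors T) ∧
        maximalIdeal T ∉ associatedPrimes T T ∧
        ∃ P ∈ minimalPrimes T,
          1 < ringKrullDim (T ⧸ P) ∧ ringKrullDim (T ⧸ P) < ringKrullDim T := by
  have hreg : ∀ a : A, a ≠ 0 → algebraMap A T a ∈ nonZeroDivisors T := fun a ha => by
    rw [mem_nonZeroDivisors_iff_right]
    intro t ht
    have := Module.Flat.isSMulRegular_of_nonZeroDivisors (M := T)
      (mem_nonZeroDivisors_of_ne_zero ha)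
    apply this
    simp [Algebra.smul_def, mul_comm, ht]
  refine ⟨fun z hz => ?_, fun hM => ?_, ?_⟩
  · rw [← map_intCast (algebraMap A T)] at hz ⊢
    exact hreg _ fun h => hz (by rw [h, map_zero])
  · have hne : maximalIdeal A ≠ ⊥ := fun hbot => hA <| isCatenary_of_coheight fun a b hab => by
      have hb : b ≤ a := (le_maximalIdeal b.2.ne_top).trans (hbot ▸ bot_le)
      exact absurd hb hab.lt.not_ge
    obtain ⟨c, hc, hc0⟩ := Submodule.exists_mem_ne_zero_of_ne_bot hne
    have h1 : algebraMap A T c ∈ ((nonZeroDivisors T : Set T))ᶜ := by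
      rw [← biUnion_associatedPrimes_eq_compl_nonZeroDivisors]
      exact Set.mem_biUnion hM (hm ▸ Ideal.mem_map_of_mem _ hc)
    exact h1 (hreg c hc0)
  · by_contra! h
    refine hA (isCatenary_of_coheight fun a b hab =>
      coheight_eq_of_forall_minimalPrimes hm hcov (fun P hP h1 P' => ?_) hab)
    have h2 := h P.asIdeal hP (by
      rw [← coheight_eq_ringKrullDim_quotient]
      exact_mod_cast h1)
    rw [← coheight_eq_ringKrullDim_quotient] at h2
    exact_mod_cast (Order.coheight_le_krullDim P').trans h2

lemma not_isCatenary_of_map_comap_eq {A T : Type} [CommRing A] [IsDomain A]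
    [IsLocalRing A] [IsNoetherianRing A] [CommRing T] [IsLocalRing T] [IsNoetherianRing T]
    [Algebra A T] [Module.Flat A T]
    (hm : (maximalIdeal A).map (algebraMap A T) = maximalIdeal T)
    (hcov : ∀ p q : PrimeSpectrum T, p ⋖ q → Order.coheight p = Order.coheight q + 1)
    {P q P₁ : PrimeSpectrum T} (hPq : P ⋖ q) (hq0 : q.asIdeal ≠ ⊥)
    (hq : ∀ P' : PrimeSpectrum T, P'.asIdeal ∈ minimalPrimes T → P' ≤ q → P' = P)
    (hmap : (q.asIdeal.comap (algebraMap A T)).map (algebraMap A T) = q.asIdeal)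
    (hlt : Order.coheight P < Order.coheight P₁) : ¬ IsCatenary A := by
  have := isLocalHom_of_map_maximalIdeal_le hm.le
  have hbot : comap (algebraMap A T) P = ⊥ := by
    obtain ⟨P₀, hP₀, hc⟩ := exists_comap_eq_of_le (A := A) (a := ⊥) (Q := P) bot_le
    obtain ⟨P', hP', hle⟩ := PrimeSpectrum.exists_minimalPrimes_le (I := ⊥) (q := P₀) bot_le
    obtain rfl := hq P' hP' (hle.trans (hP₀.trans hPq.le))
    rw [le_antisymm hle hP₀, hc]
  have hcov' : (⊥ : PrimeSpectrum A) ⋖ comap (algebraMap A T) q := by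
    refine ⟨lt_of_le_of_ne bot_le fun h => hq0 ?_, fun c hc hcq => ?_⟩
    · have h' : q.asIdeal.comap (algebraMap A T) = ⊥ := congr($(h).asIdeal).symm
      rw [← hmap, h', Ideal.map_bot]
    · obtain ⟨q', hq', rfl⟩ := exists_comap_eq_of_le hcq.le
      obtain ⟨P', hP', hle⟩ := PrimeSpectrum.exists_minimalPrimes_le (I := ⊥) (q := q') bot_le
      obtain rfl := hq P' hP' (hle.trans hq')
      rcases hPq.eq_or_eq hle hq' with rfl | rfl
      · exact hc.ne' hbot
      · exact lt_irrefl _ hcq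
  refine not_isCatenary_of_coheight_lt hcov' ?_
  obtain ⟨Q, hQ, hle⟩ := exists_coheight_le_of_isLocalHom (T := T) (comap (algebraMap A T) q)
  have hQq : q ≤ Q := hmap.ge.trans hQ.1.2
  calc Order.coheight (comap (algebraMap A T) q) + 1 ≤ Order.coheight q + 1 := by
        gcongr
        exact hle.trans (Order.coheight_anti hQq)
    _ = Order.coheight P := (hcov _ _ hPq).symm
    _ < Order.coheight P₁ := hlt
    _ ≤ Order.coheight ⊥ := coheight_le_of_map_le hm (by
        rw [PrimeSpectrum.asIdeal_bot, Ideal.map_bot]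
        exact bot_le)

end FlatLocal

/-- Characterization of completions of noncatenary local domains: a complete Noetherian
local ring `(T,M)` is the completion of a noncatenary Noetherian local domain iff
(i) no nonzero integer of `T` is a zerodivisor, (ii) `M ∉ Ass T`, and (iii) there is a
minimal prime `P` of `T` with `1 < dim (T/P) < dim T`. -/
theorem stmt5 (T : Type) [CommRing T] [IsLocalRing T] [IsNoetherianRing T]
    [IsAdicComplete (maximalIdeal T) T] :
    (∃ (A : Type) (_ : CommRing A) (_ : IsDomain A) (_ : IsLocalRing A)
        (_ : IsNoetherianRing A), ¬ IsCatenary A ∧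
        Nonempty (AdicCompletion (maximalIdeal A) A ≃+* T)) ↔
      ((∀ z : ℤ, (z : T) ≠ 0 → (z : T) ∈ nonZeroDivisors T) ∧
        maximalIdeal T ∉ associatedPrimes T T ∧
        ∃ P ∈ minimalPrimes T,
          1 < ringKrullDim (T ⧸ P) ∧ ringKrullDim (T ⧸ P) < ringKrullDim T) := by
  have hcov : ∀ p q : PrimeSpectrum T, p ⋖ q → Order.coheight p = Order.coheight q + 1 :=
    fun _ _ h => coheight_eq_of_covBy h
  constructor
  · rintro ⟨A, _, _, _, _, hA, ⟨e⟩⟩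
    let : Algebra A T :=
      ((e : AdicCompletion (maximalIdeal A) A →+* T).comp (algebraMap A _)).toAlgebra
    let e' : AdicCompletion (maximalIdeal A) A ≃ₐ[A] T :=
      AlgEquiv.ofRingEquiv (f := e) fun _ => rfl
    have : Module.Flat A T := Module.Flat.of_linearEquiv e'.symm.toLinearEquiv
    have hm : (maximalIdeal A).map (algebraMap A T) = maximalIdeal T := by
      rw [← IsLocalRing.map_maximalIdeal_of_surjective
        (e : AdicCompletion (maximalIdeal A) A →+* T) e.surjective,
        AdicCompletion.maximalIdeal_eq_map, Ideal.map_map]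
      rfl
    exact exists_minimalPrimes_of_not_isCatenary hm hcov hA
  · rintro ⟨hz, hM, P, hP, h1, hlt⟩
    let P' : PrimeSpectrum T := ⟨P, hP.isPrime⟩
    have hdim : (Order.coheight P' : WithBot ℕ∞) = ringKrullDim (T ⧸ P) :=
      PrimeSpectrum.coheight_eq_ringKrullDim_quotient P'
    rw [← hdim] at h1 hlt
    obtain ⟨P₁, hP₁⟩ : ∃ P₁ : PrimeSpectrum T, Order.coheight P' < Order.coheight P₁ := by
      rw [ringKrullDim, Order.krullDim_eq_iSup_coheight, lt_iSup_iff] at hlt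
      obtain ⟨P₁, h⟩ := hlt
      exact ⟨P₁, by exact_mod_cast h⟩
    obtain ⟨q, hPq, ⟨y, hyq, hy⟩, hq⟩ := exists_covBy_of_mem_minimalPrimes hM hcov (P := P') hP
      (by exact_mod_cast h1)
    obtain ⟨R, _, _, _, hmap, hm, ⟨e⟩⟩ := exists_subring_adicCompletion hz hM q.asIdeal ⟨y, hyq, hy⟩
    have : Module.Flat R T := Module.Flat.of_linearEquiv e.symm.toLinearEquiv
    refine ⟨R, inferInstance, inferInstance, inferInstance, inferInstance,
      not_isCatenary_of_map_comap_eq hm hcov hPq (fun h => ?_) hq hmap hP₁, ⟨e.toRingEquiv⟩⟩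
    rw [h, Ideal.mem_bot] at hyq
    exact nonZeroDivisors.ne_zero hy hyq
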